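/- arXiv:2604.24879 — 3 statements merged into one kernel-verified Lean document; each statement's English description precedes it below -/
import Mathlib

section
/- (Proposition: algorithmic construction of concise unrestrictions, partially symmetric case.) Fix integers d ≥ 1, m ≥ 1, exponents ν_1,…,ν_d ≥ 1 and dimensions m_1,…,m_d ≥ 1, and let T be a blockwise symmetric tensor (modelling an element of S^{ν_1}ℂ^{m_1} ⊗ ⋯ ⊗ S^{ν_d}ℂ^{m_d}). (1) If T lies in the closure of the set of concise blockwise symmetric tensors, then T is a restriction of a concise blockwise symmetric tensor T' (by continuous linear maps ψ_i : ℂ^{m_i} → ℂ^{m_i} applied blockwise). (2) If moreover T lies in the closure of the set of blockwise symmetric tensors which are concise and have rank at most m, then T' can be chosen so that in addition T' has border rank at most m. -/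
/-!
Statement 1: algorithmic construction of concise unrestrictions, partially symmetric case.
-/

open scoped BigOperators

namespace Stmt1

variable {d : ℕ}

/-- Index type for the arguments: block `i`, position `j` within block `i`. -/
abbrev Idx (ν : Fin d → ℕ) : Type := Σ i : Fin d, Fin (ν i)

/-- The space of (blockwise) tensors: continuous multilinear maps whose `(i,j)`-th
argument lies in `ℂ^{mdim i}`. -/
abbrev Tensor (ν mdim : Fin d → ℕ) : Type :=
  ContinuousMultilinearMap ℂ (fun p : Idx ν => (Fin (mdim p.1) → ℂ)) ℂ

/-- Blockwise symmetry: invariance under permuting the arguments within each block. -/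
def BlockSym {ν mdim : Fin d → ℕ} (T : Tensor ν mdim) : Prop :=
  ∀ (σ : ∀ i : Fin d, Equiv.Perm (Fin (ν i)))
    (x : ∀ p : Idx ν, Fin (mdim p.1) → ℂ),
    T (fun p => x ⟨p.1, σ p.1 p.2⟩) = T x

/-- Rank at most `r` (with one linear functional per block per summand). -/
def RankLE {ν mdim : Fin d → ℕ} (T : Tensor ν mdim) (r : ℕ) : Prop :=
  ∃ g : Fin r → ∀ i : Fin d, ((Fin (mdim i) → ℂ) →L[ℂ] ℂ),
    ∀ x, T x = ∑ l : Fin r, ∏ p : Idx ν, g l p.1 (x p)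

/-- Border rank at most `r`: lies in the closure of the set of blockwise symmetric
tensors of rank at most `r`. -/
def BorderRankLE {ν mdim : Fin d → ℕ} (T : Tensor ν mdim) (r : ℕ) : Prop :=
  T ∈ closure {S : Tensor ν mdim | BlockSym S ∧ RankLE S r}

/-- Conciseness in block `i`: the only `v` such that `T` vanishes on every argument tuple
whose `(i,1)`-st entry is `v` is `v = 0`. -/
def ConciseIn {ν mdim : Fin d → ℕ} (T : Tensor ν mdim) (i : Fin d) (hi : 0 < ν i) : Prop :=
  ∀ v : Fin (mdim i) → ℂ,
    (∀ x : ∀ p : Idx ν, Fin (mdim p.1) → ℂ, x ⟨i, ⟨0, hi⟩⟩ = v → T x = 0) → v = 0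

/-- Conciseness: concise in every block. -/
def Concise {ν mdim : Fin d → ℕ} (hν : ∀ i, 0 < ν i) (T : Tensor ν mdim) : Prop :=
  ∀ i : Fin d, ConciseIn T i (hν i)


section Helpers

open Filter Topology

/-- Families of endomorphisms, one per block. -/
abbrev Fam (mdim : Fin d → ℕ) : Type := ∀ i : Fin d, ((Fin (mdim i) → ℂ) →L[ℂ] (Fin (mdim i) → ℂ))

variable {ν mdim : Fin d → ℕ}

instance finTensor : FiniteDimensional ℂ (Tensor ν mdim) :=
  FiniteDimensional.of_injective
    (ContinuousMultilinearMap.toMultilinearMapLinear (R' := ℂ) (A := ℂ)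
      (M₁ := fun p : Idx ν => (Fin (mdim p.1) → ℂ)) (M₂ := ℂ))
    ContinuousMultilinearMap.toMultilinearMap_injective

instance properTensor : ProperSpace (Tensor ν mdim) := FiniteDimensional.proper ℂ _

/-- Blockwise restriction. -/
noncomputable def act (φ : Fam mdim) (S : Tensor ν mdim) : Tensor ν mdim :=
  S.compContinuousLinearMap (fun p => φ p.1)

theorem act_apply (φ : Fam mdim) (S : Tensor ν mdim) (x) :
    act φ S x = S (fun p => φ p.1 (x p)) := rfl

theorem act_act (φ ψ : Fam mdim) (S : Tensor ν mdim) : act φ (act ψ S) = act (ψ * φ) S := rfl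

theorem act_one (S : Tensor ν mdim) : act 1 S = S := rfl

theorem continuous_act : Continuous (fun q : Fam mdim × Tensor ν mdim => act q.1 q.2) := by
  have h := (ContinuousMultilinearMap.compContinuousLinearMapContinuousMultilinear ℂ
    (fun p : Idx ν => (Fin (mdim p.1) → ℂ)) (fun p : Idx ν => (Fin (mdim p.1) → ℂ)) ℂ).cont
  have h2 : Continuous (fun q : Fam mdim × Tensor ν mdim => fun p : Idx ν => q.1 p.1) := by
    fun_prop
  exact (h.comp h2).clm_apply continuous_snd

theorem tendsto_act {α : Type*} {l : Filter α} {φ : α → Fam mdim} {S : α → Tensor ν mdim}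
    {φ₀ : Fam mdim} {S₀ : Tensor ν mdim} (h1 : Tendsto φ l (𝓝 φ₀)) (h2 : Tendsto S l (𝓝 S₀)) :
    Tendsto (fun a => act (φ a) (S a)) l (𝓝 (act φ₀ S₀)) :=
  (continuous_act.tendsto (φ₀, S₀)).comp (h1.prodMk_nhds h2)

theorem isClosed_blockSym : IsClosed {S : Tensor ν mdim | BlockSym S} := by
  simp only [BlockSym, Set.ofPred_forall]
  refine isClosed_iInter fun σ => isClosed_iInter fun x => ?_
  exact isClosed_eq (continuous_eval_const _) (continuous_eval_const _)

/-- The kernel of a tensor in a block. -/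
noncomputable def kerB (i : Fin d) (hi : 0 < ν i) (S : Tensor ν mdim) :
    Submodule ℂ (Fin (mdim i) → ℂ) where
  carrier := {v | ∀ x : ∀ p : Idx ν, Fin (mdim p.1) → ℂ, S (Function.update x ⟨i, ⟨0, hi⟩⟩ v) = 0}
  add_mem' := by
    intro a b ha hb x
    have := S.map_update_add x ⟨i, ⟨0, hi⟩⟩ a b
    rw [ha x, hb x, add_zero] at this
    exact this
  zero_mem' := by
    intro x
    exact S.map_update_zero x ⟨i, ⟨0, hi⟩⟩
  smul_mem' := by
    intro c a ha x
    have := S.map_update_smul x ⟨i, ⟨0, hi⟩⟩ c a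
    rw [ha x, smul_zero] at this
    exact this

theorem mem_kerB {i : Fin d} {hi : 0 < ν i} {S : Tensor ν mdim} {v : Fin (mdim i) → ℂ} :
    v ∈ kerB i hi S ↔ ∀ x : ∀ p : Idx ν, Fin (mdim p.1) → ℂ,
      S (Function.update x ⟨i, ⟨0, hi⟩⟩ v) = 0 := Iff.rfl

theorem mem_kerB' {i : Fin d} {hi : 0 < ν i} {S : Tensor ν mdim} {v : Fin (mdim i) → ℂ} :
    v ∈ kerB i hi S ↔ ∀ x : ∀ p : Idx ν, Fin (mdim p.1) → ℂ,
      x ⟨i, ⟨0, hi⟩⟩ = v → S x = 0 := by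
  constructor
  · rintro h x rfl
    have := h x
    rwa [Function.update_eq_self] at this
  · intro h x
    exact h _ (by simp)

theorem conciseIn_iff {i : Fin d} {hi : 0 < ν i} {S : Tensor ν mdim} :
    ConciseIn S i hi ↔ kerB i hi S = ⊥ := by
  rw [Submodule.eq_bot_iff]
  simp only [mem_kerB', ConciseIn]

theorem kerB_sym {i : Fin d} {hi : 0 < ν i} {S : Tensor ν mdim} (hS : BlockSym S)
    {v : Fin (mdim i) → ℂ} (hv : v ∈ kerB i hi S) (j : Fin (ν i))
    (x : ∀ p : Idx ν, Fin (mdim p.1) → ℂ) : S (Function.update x ⟨i, j⟩ v) = 0 := by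
  classical
  have hσ : ∃ σ : ∀ k : Fin d, Equiv.Perm (Fin (ν k)), σ i ⟨0, hi⟩ = j :=
    ⟨Function.update (fun k => (1 : Equiv.Perm (Fin (ν k)))) i (Equiv.swap ⟨0, hi⟩ j), by
      rw [Function.update_self, Equiv.swap_apply_left]⟩
  obtain ⟨σ, hσ⟩ := hσ
  rw [← hS σ]
  refine mem_kerB'.1 hv _ ?_
  subst hσ
  exact Function.update_self _ _ _

theorem act_mulSingle_eq {i : Fin d} {hi : 0 < ν i} {S : Tensor ν mdim} (hS : BlockSym S)
    (P : (Fin (mdim i) → ℂ) →L[ℂ] (Fin (mdim i) → ℂ))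
    (hP : ∀ v, v - P v ∈ kerB i hi S) : act (Pi.mulSingle i P : Fam mdim) S = S := by
  classical
  ext x
  rw [act_apply]
  have key : ∀ s : Finset (Idx ν), S (fun p => if p ∈ s then
      (Pi.mulSingle i P : Fam mdim) p.1 (x p) else x p) = S x := by
    intro s
    induction s using Finset.induction_on with
    | empty => simp
    | insert a s ha ih =>
      rw [← ih]
      set y : ∀ p : Idx ν, Fin (mdim p.1) → ℂ := fun p => if p ∈ s then
        (Pi.mulSingle i P : Fam mdim) p.1 (x p) else x p with hy
      have h1 : (fun p => if p ∈ insert a s then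
          (Pi.mulSingle i P : Fam mdim) p.1 (x p) else x p)
          = Function.update y a ((Pi.mulSingle i P : Fam mdim) a.1 (x a)) := by
        funext p
        by_cases hp : p = a
        · subst hp; simp
        · simp [hp, hy]
      have h2 : y = Function.update y a (x a) := by
        funext p
        by_cases hp : p = a
        · subst hp; simp [hy, ha]
        · simp [hp]
      rw [h1]
      conv_rhs => rw [h2]
      obtain ⟨a1, j⟩ := a
      by_cases hai : a1 = i
      · subst hai
        have h3 := kerB_sym hS (hP (x ⟨a1, j⟩)) j y
        have h4 := S.map_update_sub y ⟨a1, j⟩ (x ⟨a1, j⟩) (P (x ⟨a1, j⟩))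
        rw [h4] at h3
        simp only [Pi.mulSingle_eq_same]
        exact (sub_eq_zero.1 h3).symm
      · simp [Pi.mulSingle_eq_of_ne hai]
  have := key Finset.univ
  simpa using this

/-- The flattening with the other arguments of block `i` composed with `P`. -/
noncomputable def flat (i : Fin d) (hi : 0 < ν i)
    (P : (Fin (mdim i) → ℂ) →L[ℂ] (Fin (mdim i) → ℂ)) :
    Tensor ν mdim →ₗ[ℂ] (Fin (mdim i) → ℂ) →ₗ[ℂ] ((∀ p : Idx ν, Fin (mdim p.1) → ℂ) → ℂ) :=
  LinearMap.mk₂ ℂ (fun S v x => S (Function.update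
      (fun p => (Pi.mulSingle i P : Fam mdim) p.1 (x p)) ⟨i, ⟨0, hi⟩⟩ v))
    (fun _ _ _ => rfl) (fun _ _ _ => rfl)
    (fun S a b => funext fun _ => S.map_update_add _ ⟨i, ⟨0, hi⟩⟩ a b)
    (fun c S a => funext fun _ => S.map_update_smul _ ⟨i, ⟨0, hi⟩⟩ c a)

theorem flat_apply (i : Fin d) (hi : 0 < ν i)
    (P : (Fin (mdim i) → ℂ) →L[ℂ] (Fin (mdim i) → ℂ)) (S : Tensor ν mdim) (v x) :
    flat i hi P S v x = S (Function.update
      (fun p => (Pi.mulSingle i P : Fam mdim) p.1 (x p)) ⟨i, ⟨0, hi⟩⟩ v) := rfl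

theorem flat_act (i : Fin d) (hi : 0 < ν i)
    (P M : (Fin (mdim i) → ℂ) →L[ℂ] (Fin (mdim i) → ℂ)) (hM : M * P = P)
    (S : Tensor ν mdim) (v) :
    flat i hi P (act (Pi.mulSingle i M) S) v = flat i hi P S (M v) := by
  funext x
  rw [flat_apply, flat_apply, act_apply]
  congr 1
  funext p
  by_cases hp : p = ⟨i, ⟨0, hi⟩⟩
  · subst hp; simp
  · rw [Function.update_of_ne hp, Function.update_of_ne hp]
    have : (Pi.mulSingle i M : Fam mdim) * Pi.mulSingle i P = Pi.mulSingle i P := by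
      rw [← Pi.mulSingle_mul, hM]
    have h2 := congrArg (fun f : Fam mdim => f p.1 (x p)) this
    exact h2

theorem flat_eq_zero (i : Fin d) (hi : 0 < ν i)
    (P : (Fin (mdim i) → ℂ) →L[ℂ] (Fin (mdim i) → ℂ)) (S : Tensor ν mdim) (v)
    (hv : v ∈ kerB i hi S) : flat i hi P S v = 0 := funext fun _ => hv _

/-- Existence of the normalising map. -/
theorem exists_E (i : Fin d) (hi : 0 < ν i) (T : Tensor ν mdim) (hT : BlockSym T) :
    ∃ (P : (Fin (mdim i) → ℂ) →L[ℂ] (Fin (mdim i) → ℂ))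
      (E : Tensor ν mdim → ((Fin (mdim i) → ℂ) →L[ℂ] (Fin (mdim i) → ℂ))),
      P * P = P ∧ (∀ v, P v = 0 ↔ v ∈ kerB i hi T) ∧ Continuous E ∧ E T = P ∧
      (∀ S, P * E S = E S) ∧
      (∀ S M, M * P = P → E (act (Pi.mulSingle i M) S) = E S * M) ∧
      (∀ S, ∀ v ∈ kerB i hi S, E S v = 0) := by
  obtain ⟨X, hX⟩ := Submodule.exists_isCompl (kerB i hi T)
  set P₀ := Submodule.projection _ _ hX.symm with hP₀
  set P := LinearMap.toContinuousLinearMap P₀ with hPdef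
  have hPv : ∀ v, P v = P₀ v := fun v => rfl
  have hPP : P * P = P := by
    ext1 v
    change P₀ (P₀ v) = P₀ v
    exact Submodule.projection_apply_of_mem_left hX.symm (Submodule.projection_apply_mem _ _)
  have hP0 : ∀ v, P v = 0 ↔ v ∈ kerB i hi T := fun v => by
    rw [hPv]; exact Submodule.projection_apply_eq_zero_iff hX.symm
  have hPX : ∀ v ∈ X, P v = v := fun v hv =>
    Submodule.projection_apply_of_mem_left hX.symm hv
  have hPmem : ∀ v, P v ∈ X := fun v => Submodule.projection_apply_mem hX.symm v
  have hsub : ∀ v, v - P v ∈ kerB i hi T := fun v => by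
    rw [← hP0, map_sub, sub_eq_zero]
    exact (DFunLike.congr_fun hPP v).symm
  have hPT : act (Pi.mulSingle i P : Fam mdim) T = T := act_mulSingle_eq hT P hsub
  have hinj : LinearMap.ker ((flat i hi P T).comp X.subtype) = ⊥ := by
    rw [Submodule.eq_bot_iff]
    rintro ⟨v, hv⟩ h
    have h' : flat i hi P T v = 0 := h
    have : v ∈ kerB i hi T := by
      intro x
      have h2 := congrFun h' x
      rw [flat_apply] at h2
      rw [← hPT, act_apply]
      refine Eq.trans ?_ h2
      congr 1
      funext p
      by_cases hp : p = ⟨i, ⟨0, hi⟩⟩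
      · subst hp; simp [hPX v hv]
      · rw [Function.update_of_ne hp, Function.update_of_ne hp]
    have h0 : v = 0 := by rw [← hPX v hv]; exact (hP0 v).2 this
    exact Subtype.ext h0
  obtain ⟨C, hC⟩ := LinearMap.exists_leftInverse_of_injective _ hinj
  let E' : Tensor ν mdim →ₗ[ℂ] ((Fin (mdim i) → ℂ) →L[ℂ] (Fin (mdim i) → ℂ)) :=
    LinearMap.toContinuousLinearMap.toLinearMap ∘ₗ
      (LinearMap.compRight ℂ (X.subtype ∘ₗ C)) ∘ₗ flat i hi P
  have hE : ∀ S v, E' S v = (C (flat i hi P S v) : Fin (mdim i) → ℂ) := fun S v => rfl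
  refine ⟨P, E', hPP, hP0, E'.continuous_of_finiteDimensional, ?_, ?_, ?_, ?_⟩
  · ext1 v
    rw [hE]
    have h1 : flat i hi P T v = flat i hi P T (P v) := by
      rw [← sub_eq_zero, ← map_sub]
      exact flat_eq_zero _ _ _ _ _ (hsub v)
    have h2 := DFunLike.congr_fun hC ⟨P v, hPmem v⟩
    rw [h1]
    exact congrArg Subtype.val h2
  · intro S
    ext1 v
    change P (E' S v) = E' S v
    rw [hE]
    exact hPX _ (Subtype.mem _)
  · intro S M hM
    ext1 v
    change E' _ v = E' S (M v)
    rw [hE, hE, flat_act i hi P M hM]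
  · intro S v hv
    rw [hE, flat_eq_zero _ _ _ _ _ hv]; simp

/-- The scaling maps are invertible. -/
theorem scale_mul {R : Type*} [Ring R] [Algebra ℂ R] {P U : R} (hPP : P * P = P) (hUP : U * P = P)
    (hPU : P * U = U) {t : ℂ} (ht : t ≠ 0) :
    (P + t • (1 - U)) * (U + t⁻¹ • (1 - P)) = 1 ∧
    (U + t⁻¹ • (1 - P)) * (P + t • (1 - U)) = 1 := by
  have hUU : U * U = U := by
    calc U * U = U * (P * U) := by rw [hPU]
      _ = U := by rw [← mul_assoc, hUP, hPU]
  constructor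
  · simp only [add_mul, mul_add, smul_mul_assoc, mul_smul_comm, mul_sub, sub_mul, one_mul, mul_one,
      hPP, hUP, hPU, hUU, sub_self, smul_zero]
    simp [smul_smul, mul_inv_cancel₀ ht, inv_mul_cancel₀ ht]
  · simp only [add_mul, mul_add, smul_mul_assoc, mul_smul_comm, mul_sub, sub_mul, one_mul, mul_one,
      hPP, hUP, hPU, hUU, sub_self, smul_zero]
    simp [smul_smul, mul_inv_cancel₀ ht, inv_mul_cancel₀ ht]

theorem mul_scale {R : Type*} [Ring R] [Algebra ℂ R] {E P X : R} (h : E * X = 0) (t : ℂ) :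
    E * (P + t • X) = E * P := by
  rw [mul_add, mul_smul_comm, h, smul_zero, add_zero]

theorem scale_mul_right {R : Type*} [Ring R] [Algebra ℂ R] {E P X : R} (h : X * E = 0) (t : ℂ) :
    (P + t • X) * E = P * E := by
  rw [add_mul, smul_mul_assoc, h, smul_zero, add_zero]

theorem tendsto_add_smul {R α : Type*} [NormedRing R] [NormedAlgebra ℂ R] {l : Filter α}
    {u : α → R} {s : α → ℂ} {a : R} (hu : Tendsto u l (𝓝 a)) (hs : Tendsto s l (𝓝 0)) (c : R) :
    Tendsto (fun k => u k + s k • c) l (𝓝 a) := by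
  have := hu.add (hs.smul_const c)
  rwa [zero_smul, add_zero] at this

theorem ring_U {R : Type*} [Ring R] {P E : R} (hPP : P * P = P) (hPE : P * E = E)
    (hu : IsUnit (E * P + (1 - P))) :
    (Ring.inverse (E * P + (1 - P)) * E) * P = P ∧
    P * (Ring.inverse (E * P + (1 - P)) * E) = Ring.inverse (E * P + (1 - P)) * E ∧
    E * (1 - Ring.inverse (E * P + (1 - P)) * E) = 0 := by
  set G := E * P + (1 - P) with hG
  have h1 : Ring.inverse G * G = 1 := Ring.inverse_mul_cancel _ hu
  have h2 : G * Ring.inverse G = 1 := Ring.mul_inverse_cancel _ hu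
  have hGP : G * P = E * P := by
    rw [hG]; simp only [add_mul, sub_mul, mul_assoc, hPP, one_mul, sub_self, add_zero]
  have hQG : (1 - P) * G = 1 - P := by
    rw [hG]
    simp only [mul_add, sub_mul, mul_sub, ← mul_assoc, hPP, hPE, one_mul, mul_one, sub_self,
      zero_add, sub_zero, zero_mul]
  have hQI : (1 - P) * Ring.inverse G = 1 - P := by
    calc (1 - P) * Ring.inverse G = (1 - P) * G * Ring.inverse G := by rw [hQG]
      _ = 1 - P := by rw [mul_assoc, h2, mul_one]
  have hQU : (1 - P) * (Ring.inverse G * E) = 0 := by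
    rw [← mul_assoc, hQI, sub_mul, one_mul, hPE, sub_self]
  have hPU : P * (Ring.inverse G * E) = Ring.inverse G * E := by
    rw [sub_mul, one_mul, sub_eq_zero] at hQU
    exact hQU.symm
  refine ⟨?_, hPU, ?_⟩
  · rw [mul_assoc, ← hGP, ← mul_assoc, h1, one_mul]
  · have h3 : G * (Ring.inverse G * E) = E := by rw [← mul_assoc, h2, one_mul]
    have h4 : G * (Ring.inverse G * E) = E * (Ring.inverse G * E) := by
      conv_lhs => rw [hG, add_mul, hQU, add_zero, mul_assoc, hPU]
    rw [mul_sub, mul_one, ← h4, h3, sub_self]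

theorem continuous_mulSingle (i : Fin d) : Continuous
    (fun P : (Fin (mdim i) → ℂ) →L[ℂ] (Fin (mdim i) → ℂ) => (Pi.mulSingle i P : Fam mdim)) := by
  have : Continuous fun P : (Fin (mdim i) → ℂ) →L[ℂ] (Fin (mdim i) → ℂ) =>
      Function.update (1 : Fam mdim) i P := continuous_const.update i continuous_id
  exact this

/-- If scaling stays bounded, the tensor factors through `U`. -/
theorem exists_large {i : Fin d} {hi : 0 < ν i} {S : Tensor ν mdim} (hS : kerB i hi S = ⊥)
    {P U : (Fin (mdim i) → ℂ) →L[ℂ] (Fin (mdim i) → ℂ)} (hPP : P * P = P) (hUP : U * P = P)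
    (hPU : P * U = U) (hP : P ≠ 1) (c : ℝ) (N : ℕ) :
    ∃ t : ℝ, (N : ℝ) + 1 ≤ t ∧
      c < ‖act (Pi.mulSingle i (P + (t : ℂ) • (1 - U)) : Fam mdim) S‖ := by
  by_contra! hcon
  have hb : ∀ k : ℕ, act (Pi.mulSingle i (P + ((N + 1 + k : ℝ) : ℂ) • (1 - U)) : Fam mdim) S
      ∈ Metric.closedBall (0 : Tensor ν mdim) c := fun k => by
    rw [mem_closedBall_zero_iff]
    exact hcon _ (by linarith [(Nat.cast_nonneg k : (0:ℝ) ≤ k)])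
  obtain ⟨R, -, φ, hφ, hR⟩ := tendsto_subseq_of_bounded Metric.isBounded_closedBall hb
  have ht : Tendsto (fun k : ℕ => (((N + 1 + k : ℝ) : ℂ))⁻¹) atTop (𝓝 0) := by
    have h1 : Tendsto (fun k : ℕ => ((N + 1 + k : ℝ))⁻¹) atTop (𝓝 0) :=
      tendsto_inv_atTop_zero.comp
        (tendsto_atTop_add_const_left _ _ tendsto_natCast_atTop_atTop)
    have h2 := (Complex.continuous_ofReal.tendsto 0).comp h1
    simpa [Function.comp_def] using h2
  have hN : Tendsto (fun k : ℕ => U + (((N + 1 + φ k : ℝ) : ℂ))⁻¹ • (1 - P)) atTop (𝓝 U) :=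
    tendsto_add_smul tendsto_const_nhds (ht.comp hφ.tendsto_atTop) (1 - P)
  have h3 := tendsto_act (((continuous_mulSingle i).tendsto U).comp hN) hR
  have h4 : ∀ k, act (Pi.mulSingle i (U + (((N + 1 + φ k : ℝ) : ℂ))⁻¹ • (1 - P)) : Fam mdim)
      (act (Pi.mulSingle i (P + ((N + 1 + φ k : ℝ) : ℂ) • (1 - U)) : Fam mdim) S) = S := by
    intro k
    have hne : ((N + 1 + φ k : ℝ) : ℂ) ≠ 0 := by
      rw [Complex.ofReal_ne_zero]; positivity
    rw [act_act, ← Pi.mulSingle_mul, (scale_mul hPP hUP hPU hne).1, Pi.mulSingle_one, act_one]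
  have h5 : S = act (Pi.mulSingle i U : Fam mdim) R := by
    refine tendsto_nhds_unique ?_ h3
    refine tendsto_const_nhds.congr fun k => ?_
    exact (h4 k).symm
  have hU1 : U * (1 - U) = 0 := by
    have hUU : U * U = U := by
      calc U * U = U * (P * U) := by rw [hPU]
        _ = U := by rw [← mul_assoc, hUP, hPU]
    rw [mul_sub, mul_one, hUU, sub_self]
  have h6 : U = 1 := by
    ext1 v
    have hv : v - U v ∈ kerB i hi S := by
      rw [mem_kerB', h5]
      intro x hx
      rw [act_apply]
      refine R.map_coord_zero ⟨i, ⟨0, hi⟩⟩ ?_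
      simp only [Pi.mulSingle_eq_same]
      rw [hx]
      exact DFunLike.congr_fun hU1 v
    rw [hS, Submodule.mem_bot, sub_eq_zero] at hv
    exact hv.symm
  apply hP
  rw [h6, one_mul] at hUP
  rw [h6, mul_one] at hPU
  exact hPU

theorem step (hν : ∀ i, 0 < ν i) (C : Set (Tensor ν mdim)) (hsym : ∀ S ∈ C, BlockSym S)
    (hcon : ∀ S ∈ C, ∀ i, kerB i (hν i) S = ⊥)
    (hact : ∀ S ∈ C, ∀ φ ψ : Fam mdim, φ * ψ = 1 → ψ * φ = 1 → act φ S ∈ C)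
    (T : Tensor ν mdim) (hT : T ∈ closure C) (i : Fin d) (hK : kerB i (hν i) T ≠ ⊥) :
    ∃ T' ∈ closure C, ∃ P : (Fin (mdim i) → ℂ) →L[ℂ] (Fin (mdim i) → ℂ),
      T = act (Pi.mulSingle i P) T' ∧ kerB i (hν i) T' < kerB i (hν i) T := by
  have hclos : ∀ S ∈ closure C, BlockSym S := fun S hS =>
    (isClosed_blockSym.closure_subset_iff.2 hsym) hS
  obtain ⟨P, E, hPP, hP0, hEc, hET, hPE, hEM, hEk⟩ := exists_E i (hν i) T (hclos T hT)
  have hsub : ∀ v, v - P v ∈ kerB i (hν i) T := fun v => by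
    rw [← hP0, map_sub, sub_eq_zero]
    exact (DFunLike.congr_fun hPP v).symm
  have hPT : act (Pi.mulSingle i P : Fam mdim) T = T := act_mulSingle_eq (hclos T hT) P hsub
  have hP1 : P ≠ 1 := by
    intro h
    apply hK
    rw [Submodule.eq_bot_iff]
    intro v hv
    have := (hP0 v).2 hv
    rw [h] at this
    exact this
  let G : Tensor ν mdim → ((Fin (mdim i) → ℂ) →L[ℂ] (Fin (mdim i) → ℂ)) :=
    fun S => E S * P + (1 - P)
  let U : Tensor ν mdim → ((Fin (mdim i) → ℂ) →L[ℂ] (Fin (mdim i) → ℂ)) :=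
    fun S => Ring.inverse (E S * P + (1 - P)) * E S
  have hGT : G T = 1 := by simp [G, hET, hPP]
  have hGc : Continuous G := (hEc.mul continuous_const).add continuous_const
  have hUT : U T = P := by
    change Ring.inverse (G T) * E T = P
    rw [hGT, Ring.inverse_one, one_mul, hET]
  have hUc : Tendsto U (𝓝 T) (𝓝 P) := by
    have h1 : Tendsto Ring.inverse (𝓝 (G T)) (𝓝 (Ring.inverse (G T))) := by
      rw [hGT]
      exact NormedRing.inverse_continuousAt 1
    have h2 := (h1.comp (hGc.tendsto T)).mul (hEc.tendsto T)
    rw [← hUT]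
    exact h2
  have hunit : ∀ᶠ S in 𝓝 T, IsUnit (G S) := by
    have : {x : (Fin (mdim i) → ℂ) →L[ℂ] (Fin (mdim i) → ℂ) | IsUnit x} ∈ 𝓝 (G T) :=
      Units.isOpen.mem_nhds (by rw [hGT]; exact isUnit_one)
    exact hGc.tendsto T this
  -- the scaled tensors
  let M : ℝ → Tensor ν mdim → ((Fin (mdim i) → ℂ) →L[ℂ] (Fin (mdim i) → ℂ)) :=
    fun t S => P + (t : ℂ) • (1 - U S)
  let f : ℝ → Tensor ν mdim → ℝ := fun t S =>
    ‖act (Pi.mulSingle i (M t S) : Fam mdim) S - act (Pi.mulSingle i P : Fam mdim) S‖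
  have hPt : Tendsto (fun S => act (Pi.mulSingle i P : Fam mdim) S) (𝓝 T) (𝓝 T) := by
    have := tendsto_act (tendsto_const_nhds (x := (Pi.mulSingle i P : Fam mdim)) (f := 𝓝 T))
      (tendsto_id (x := 𝓝 T))
    rw [hPT] at this
    exact this
  have hf0 : ∀ t : ℝ, Tendsto (f t) (𝓝 T) (𝓝 0) := by
    intro t
    have h1 : Tendsto (M t) (𝓝 T) (𝓝 (P + (t : ℂ) • (1 - P))) :=
      ((hUc.const_sub 1).const_smul (t : ℂ)).const_add P
    have h2 := tendsto_act (((continuous_mulSingle i).tendsto _).comp h1) (tendsto_id (x := 𝓝 T))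
    have h3 : act (Pi.mulSingle i (P + (t : ℂ) • (1 - P)) : Fam mdim) T = T := by
      conv_lhs => rw [← hPT]
      rw [act_act, ← Pi.mulSingle_mul]
      have : P * (P + (t : ℂ) • (1 - P)) = P :=
        (mul_scale (by rw [mul_sub, mul_one, hPP, sub_self]) _).trans hPP
      rw [this, hPT]
    rw [h3] at h2
    have h4 := (h2.sub hPt).norm
    rw [sub_self, norm_zero] at h4
    exact h4
  have : (𝓝[C] T).NeBot := mem_closure_iff_nhdsWithin_neBot.1 hT
  have hex : ∀ N : ℕ, ∃ S ∈ C, IsUnit (G S) ∧ dist S T < 1 / ((N : ℝ) + 1) ∧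
      ∃ t : ℝ, (N : ℝ) + 1 ≤ t ∧ f t S = 1 := by
    intro N
    have hpos : 0 < 1 / ((N : ℝ) + 1) := by positivity
    have e1 : ∀ᶠ S in 𝓝[C] T, IsUnit (G S) := nhdsWithin_le_nhds hunit
    have e2 : ∀ᶠ S in 𝓝[C] T, dist S T < 1 / ((N : ℝ) + 1) :=
      nhdsWithin_le_nhds (Metric.ball_mem_nhds T hpos)
    have e3 : ∀ᶠ S in 𝓝[C] T, f ((N : ℝ) + 1) S < 1 :=
      nhdsWithin_le_nhds ((hf0 ((N : ℝ) + 1)).eventually_lt_const one_pos)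
    have e4 : ∀ᶠ S in 𝓝[C] T, S ∈ C := eventually_mem_nhdsWithin
    obtain ⟨S, h1, h2, h3, h4⟩ := (e1.and (e2.and (e3.and e4))).exists
    refine ⟨S, h4, h1, h2, ?_⟩
    obtain ⟨hUP, hPU, -⟩ := ring_U hPP (hPE S) h1
    obtain ⟨t, ht, hlt⟩ := exists_large (hcon S h4 i) hPP hUP hPU hP1
      (1 + ‖act (Pi.mulSingle i P : Fam mdim) S‖) N
    have h5 : 1 ≤ f t S := by
      have := norm_sub_norm_le (act (Pi.mulSingle i (M t S) : Fam mdim) S)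
        (act (Pi.mulSingle i P : Fam mdim) S)
      change 1 ≤ ‖_ - _‖
      refine le_trans ?_ this
      have hlt' : 1 + ‖act (Pi.mulSingle i P : Fam mdim) S‖
        < ‖act (Pi.mulSingle i (M t S) : Fam mdim) S‖ := hlt
      linarith
    have hc : Continuous (fun t => f t S) := by
      have hM : Continuous (fun t => M t S) :=
        continuous_const.add (Complex.continuous_ofReal.smul continuous_const)
      have hA : Continuous (fun t => act (Pi.mulSingle i (M t S) : Fam mdim) S) :=
        continuous_act.comp (((continuous_mulSingle i).comp hM).prodMk continuous_const)
      exact (hA.sub continuous_const).norm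
    obtain ⟨s, hs, hs1⟩ := intermediate_value_Icc ht hc.continuousOn ⟨h3.le, h5⟩
    exact ⟨s, hs.1, hs1⟩
  choose S hSC hSu hSd t ht hft using hex
  have hST : Tendsto S atTop (𝓝 T) := by
    rw [tendsto_iff_dist_tendsto_zero]
    exact squeeze_zero (fun _ => dist_nonneg) (fun n => (hSd n).le)
      tendsto_one_div_add_atTop_nhds_zero_nat
  let R : ℕ → Tensor ν mdim := fun n => act (Pi.mulSingle i (M (t n) (S n)) : Fam mdim) (S n)
  have htne : ∀ n, ((t n : ℝ) : ℂ) ≠ 0 := fun n => by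
    rw [Complex.ofReal_ne_zero]
    have := ht n
    have h2 : (0 : ℝ) ≤ n := Nat.cast_nonneg n
    linarith
  have hRC : ∀ n, R n ∈ C := by
    intro n
    obtain ⟨hUP, hPU, -⟩ := ring_U hPP (hPE (S n)) (hSu n)
    obtain ⟨a1, a2⟩ := scale_mul hPP hUP hPU (htne n)
    refine hact _ (hSC n) _ (Pi.mulSingle i (U (S n) + (t n : ℂ)⁻¹ • (1 - P))) ?_ ?_
    · rw [← Pi.mulSingle_mul, a1, Pi.mulSingle_one]
    · rw [← Pi.mulSingle_mul, a2, Pi.mulSingle_one]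
  have hPS : Tendsto (fun n => act (Pi.mulSingle i P : Fam mdim) (S n)) atTop (𝓝 T) :=
    hPt.comp hST
  obtain ⟨c, hc⟩ := (Metric.isBounded_range_of_tendsto _ hPS).exists_norm_le
  have hRb : ∀ n, R n ∈ Metric.closedBall (0 : Tensor ν mdim) (1 + c) := by
    intro n
    rw [mem_closedBall_zero_iff]
    have h1 := norm_sub_norm_le (R n) (act (Pi.mulSingle i P : Fam mdim) (S n))
    have h2 := hc _ (Set.mem_range_self n)
    have h3 : ‖R n - act (Pi.mulSingle i P : Fam mdim) (S n)‖ = 1 := hft n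
    linarith
  obtain ⟨T', -, φ, hφ, hR⟩ := tendsto_subseq_of_bounded Metric.isBounded_closedBall hRb
  have hT'C : T' ∈ closure C := mem_closure_of_tendsto hR (Eventually.of_forall fun n => hRC _)
  have hSφ : Tendsto (S ∘ φ) atTop (𝓝 T) := hST.comp hφ.tendsto_atTop
  have htinf : Tendsto (fun n => ((t (φ n) : ℝ) : ℂ)⁻¹) atTop (𝓝 0) := by
    have h0 : Tendsto t atTop atTop :=
      tendsto_atTop_mono (fun n => (by linarith [ht n] : (n : ℝ) ≤ t n))
        tendsto_natCast_atTop_atTop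
    have h1 : Tendsto (fun n => (t (φ n))⁻¹) atTop (𝓝 0) :=
      tendsto_inv_atTop_zero.comp (h0.comp hφ.tendsto_atTop)
    have h2 := (Complex.continuous_ofReal.tendsto 0).comp h1
    simpa [Function.comp_def] using h2
  have hTeq : T = act (Pi.mulSingle i P) T' := by
    have hN : Tendsto (fun n => U (S (φ n)) + ((t (φ n) : ℝ) : ℂ)⁻¹ • (1 - P)) atTop (𝓝 P) :=
      tendsto_add_smul (hUc.comp hSφ) htinf (1 - P)
    have h3 := tendsto_act (((continuous_mulSingle i).tendsto P).comp hN) hR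
    refine tendsto_nhds_unique (hSφ.congr fun n => ?_) h3
    obtain ⟨hUP, hPU, -⟩ := ring_U hPP (hPE (S (φ n))) (hSu (φ n))
    obtain ⟨a1, a2⟩ := scale_mul hPP hUP hPU (htne (φ n))
    change S (φ n) = act (Pi.mulSingle i (U (S (φ n)) + ((t (φ n) : ℝ) : ℂ)⁻¹ • (1 - P)) : Fam mdim)
      (act (Pi.mulSingle i (P + ((t (φ n) : ℝ) : ℂ) • (1 - U (S (φ n)))) : Fam mdim) (S (φ n)))
    rw [act_act, ← Pi.mulSingle_mul, a1, Pi.mulSingle_one, act_one]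
  have hET' : E T' = P := by
    have h1 := (hEc.tendsto T').comp hR
    have h2 : Tendsto (fun n => E (S (φ n)) * P) atTop (𝓝 P) := by
      have := ((hEc.tendsto T).comp hSφ).mul_const P
      rw [hET, hPP] at this
      exact this
    refine tendsto_nhds_unique h1 (h2.congr fun n => ?_)
    obtain ⟨hUP, hPU, hEU⟩ := ring_U hPP (hPE (S (φ n))) (hSu (φ n))
    have hMP : M (t (φ n)) (S (φ n)) * P = P :=
      (scale_mul_right (by rw [sub_mul, one_mul, hUP, sub_self]) _).trans hPP
    have h3 : E (R (φ n)) = E (S (φ n)) * M (t (φ n)) (S (φ n)) := hEM _ _ hMP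
    change _ = E (R (φ n))
    rw [h3]
    exact (mul_scale hEU _).symm
  have hle : kerB i (hν i) T' ≤ kerB i (hν i) T := by
    intro v hv
    rw [← hP0, ← hET']
    exact hEk _ v hv
  refine ⟨T', hT'C, P, hTeq, lt_of_le_of_ne hle fun heq => ?_⟩
  have h1 : act (Pi.mulSingle i P : Fam mdim) T' = T' :=
    act_mulSingle_eq (hclos T' hT'C) P (by rw [heq]; exact hsub)
  have h2 : T = T' := hTeq.trans h1
  have h3 := (hR.sub (hPS.comp hφ.tendsto_atTop)).norm
  rw [← h2, sub_self, norm_zero] at h3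
  have h4 : (0 : ℝ) = 1 := by
    refine tendsto_nhds_unique h3 (tendsto_const_nhds.congr fun n => ?_)
    exact (hft (φ n)).symm
  exact zero_ne_one h4

theorem kerB_act_le {j : Fin d} {hj : 0 < ν j} {φ : Fam mdim} (hφ : φ j = 1)
    (S : Tensor ν mdim) : kerB j hj S ≤ kerB j hj (act φ S) := by
  intro v hv
  rw [mem_kerB'] at hv ⊢
  intro x hx
  rw [act_apply]
  apply hv
  simp only [hφ, hx]
  rfl

theorem main_aux (hν : ∀ i, 0 < ν i) (C : Set (Tensor ν mdim)) (hsym : ∀ S ∈ C, BlockSym S)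
    (hcon : ∀ S ∈ C, ∀ i, kerB i (hν i) S = ⊥)
    (hact : ∀ S ∈ C, ∀ φ ψ : Fam mdim, φ * ψ = 1 → ψ * φ = 1 → act φ S ∈ C) (n : ℕ) :
    ∀ T ∈ closure C, ∑ i, Module.finrank ℂ (kerB i (hν i) T) = n →
      ∃ T' ∈ closure C, ∃ ψ : Fam mdim, Concise hν T' ∧ T = act ψ T' := by
  induction n using Nat.strong_induction_on with
  | _ n ih =>
    intro T hT hn
    by_cases h : ∀ i, kerB i (hν i) T = ⊥
    · exact ⟨T, hT, 1, fun i => conciseIn_iff.2 (h i), (act_one T).symm⟩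
    · push Not at h
      obtain ⟨i, hi⟩ := h
      obtain ⟨T₁, hT₁, P, hP, hlt⟩ := step hν C hsym hcon hact T hT i hi
      have hsum : ∑ j, Module.finrank ℂ (kerB j (hν j) T₁) < n := by
        rw [← hn]
        refine Finset.sum_lt_sum (fun j _ => ?_) ⟨i, Finset.mem_univ i,
          Submodule.finrank_lt_finrank_of_lt hlt⟩
        by_cases hj : j = i
        · subst hj; exact Submodule.finrank_mono hlt.le
        · have h1 : (Pi.mulSingle i P : Fam mdim) j = 1 := by simp [Pi.mulSingle_eq_of_ne hj]
          have h2 : kerB j (hν j) T₁ ≤ kerB j (hν j) T := by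
            have h3 := kerB_act_le (hj := hν j) h1 T₁
            rw [← hP] at h3
            exact h3
          exact Submodule.finrank_mono h2
      obtain ⟨T', hT', ψ, hc, hψ⟩ := ih _ hsum T₁ hT₁ rfl
      exact ⟨T', hT', ψ * Pi.mulSingle i P, hc, by rw [hP, hψ, act_act]⟩

theorem blockSym_act {S : Tensor ν mdim} (hS : BlockSym S) (φ : Fam mdim) :
    BlockSym (act φ S) := fun σ x => hS σ (fun p => φ p.1 (x p))

theorem kerB_act_bot {i : Fin d} {hi : 0 < ν i} {S : Tensor ν mdim} (hS : kerB i hi S = ⊥)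
    {φ ψ : Fam mdim} (h1 : φ * ψ = 1) (h2 : ψ * φ = 1) : kerB i hi (act φ S) = ⊥ := by
  have h1' : ∀ (j : Fin d) v, φ j (ψ j v) = v := fun j v => by
    have h : φ j * ψ j = 1 := congrFun h1 j
    change (φ j * ψ j) v = v
    rw [h]
    rfl
  have h2' : ∀ (j : Fin d) v, ψ j (φ j v) = v := fun j v => by
    have h : ψ j * φ j = 1 := congrFun h2 j
    change (ψ j * φ j) v = v
    rw [h]
    rfl
  rw [Submodule.eq_bot_iff]
  intro v hv
  have : φ i v ∈ kerB i hi S := by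
    rw [mem_kerB'] at hv ⊢
    intro x hx
    have := hv (fun p => ψ p.1 (x p)) (by simp only [hx, h2'])
    rw [act_apply] at this
    simpa only [h1'] using this
  rw [hS, Submodule.mem_bot] at this
  rw [← h2' i v, this, map_zero]

theorem rankLE_act {S : Tensor ν mdim} {r : ℕ} (hS : RankLE S r) (φ : Fam mdim) :
    RankLE (act φ S) r := by
  obtain ⟨g, hg⟩ := hS
  exact ⟨fun l i => (g l i).comp (φ i), fun x => hg _⟩

end Helpers

/-- **Algorithmic construction of concise unrestrictions, partially symmetric case.**
(1) If `T` lies in the closure of the set of concise blockwise symmetric tensors, then `T`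
is a restriction of a concise blockwise symmetric tensor.
(2) If moreover `T` lies in the closure of the set of blockwise symmetric tensors that are
concise and of rank at most `m`, then the unrestriction can additionally be chosen of
border rank at most `m`. -/
theorem algorithmic_concise_unrestriction
    (d m : ℕ) (hd : 1 ≤ d) (hm : 1 ≤ m)
    (ν mdim : Fin d → ℕ) (hν : ∀ i, 0 < ν i) (hmdim : ∀ i, 1 ≤ mdim i)
    (T : Tensor ν mdim) (hTsym : BlockSym T) :
    (T ∈ closure {S : Tensor ν mdim | BlockSym S ∧ Concise hν S} →
      ∃ (T' : Tensor ν mdim)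
        (ψ : ∀ i : Fin d, ((Fin (mdim i) → ℂ) →L[ℂ] (Fin (mdim i) → ℂ))),
        BlockSym T' ∧ Concise hν T' ∧
        ∀ x : ∀ p : Idx ν, Fin (mdim p.1) → ℂ, T x = T' (fun p => ψ p.1 (x p))) ∧
    (T ∈ closure {S : Tensor ν mdim | BlockSym S ∧ Concise hν S ∧ RankLE S m} →
      ∃ (T' : Tensor ν mdim)
        (ψ : ∀ i : Fin d, ((Fin (mdim i) → ℂ) →L[ℂ] (Fin (mdim i) → ℂ))),
        BlockSym T' ∧ Concise hν T' ∧ BorderRankLE T' m ∧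
        ∀ x : ∀ p : Idx ν, Fin (mdim p.1) → ℂ, T x = T' (fun p => ψ p.1 (x p))) := by
  have hcl : ∀ C : Set (Tensor ν mdim), (∀ S ∈ C, BlockSym S) → ∀ S ∈ closure C, BlockSym S :=
    fun C hsym S hS => (isClosed_blockSym.closure_subset_iff.2 hsym) hS
  constructor
  · intro hT
    obtain ⟨T', hT', ψ, hc, hψ⟩ := main_aux hν {S : Tensor ν mdim | BlockSym S ∧ Concise hν S}
      (fun S hS => hS.1) (fun S hS i => conciseIn_iff.1 (hS.2 i))
      (fun S hS φ ψ h1 h2 => ⟨blockSym_act hS.1 φ, fun i =>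
        conciseIn_iff.2 (kerB_act_bot (conciseIn_iff.1 (hS.2 i)) h1 h2)⟩) _ T hT rfl
    exact ⟨T', ψ, hcl _ (fun S hS => hS.1) T' hT', hc, fun x => by rw [hψ, act_apply]⟩
  · intro hT
    obtain ⟨T', hT', ψ, hc, hψ⟩ := main_aux hν
      {S : Tensor ν mdim | BlockSym S ∧ Concise hν S ∧ RankLE S m}
      (fun S hS => hS.1) (fun S hS i => conciseIn_iff.1 (hS.2.1 i))
      (fun S hS φ ψ h1 h2 => ⟨blockSym_act hS.1 φ, fun i =>
        conciseIn_iff.2 (kerB_act_bot (conciseIn_iff.1 (hS.2.1 i)) h1 h2),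
        rankLE_act hS.2.2 φ⟩) _ T hT rfl
    have hsub : {S : Tensor ν mdim | BlockSym S ∧ Concise hν S ∧ RankLE S m} ⊆
        {S : Tensor ν mdim | BlockSym S ∧ RankLE S m} := fun S hS => ⟨hS.1, hS.2.2⟩
    exact ⟨T', ψ, hcl _ (fun S hS => hS.1) T' hT', hc, closure_mono hsub hT', fun x => by rw [hψ, act_apply]⟩

end Stmt1
end

section
/- (Proposition: algorithmic construction of concise unrestrictions, Segre case.) Fix integers d ≥ 1, m ≥ 1 and dimensions m_1,…,m_d ≥ 1, and let T be an order-d tensor (a continuous multilinear map ℂ^{m_1} × ⋯ × ℂ^{m_d} → ℂ). If T lies in the closure of the set of tensors which are concise and have rank at most m, then there exist a concise tensor T' of border rank at most m and continuous linear maps ψ_1,…,ψ_d with ψ_i : ℂ^{m_i} → ℂ^{m_i}, such that T(x_1,…,x_d) = T'(ψ_1(x_1),…,ψ_d(x_d)) for all x_1,…,x_d. -/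
/-!
Statement 2: algorithmic construction of concise unrestrictions, Segre case.
-/

open scoped BigOperators

namespace Stmt2

variable {d : ℕ}

/-- Order-`d` tensors in `ℂ^{mdim 1} ⊗ ⋯ ⊗ ℂ^{mdim d}`, modelled as continuous multilinear
maps. -/
abbrev Tensor (mdim : Fin d → ℕ) : Type :=
  ContinuousMultilinearMap ℂ (fun i : Fin d => (Fin (mdim i) → ℂ)) ℂ

/-- Rank at most `r`. -/
def RankLE {mdim : Fin d → ℕ} (T : Tensor mdim) (r : ℕ) : Prop :=
  ∃ g : Fin r → ∀ i : Fin d, ((Fin (mdim i) → ℂ) →L[ℂ] ℂ),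
    ∀ x, T x = ∑ l : Fin r, ∏ i : Fin d, g l i (x i)

/-- Border rank at most `r`: lies in the closure of the set of tensors of rank at most `r`. -/
def BorderRankLE {mdim : Fin d → ℕ} (T : Tensor mdim) (r : ℕ) : Prop :=
  T ∈ closure {S : Tensor mdim | RankLE S r}

/-- Conciseness: in every slot `i`, the only `v` such that `T` vanishes on every argument
tuple whose `i`-th entry is `v` is `v = 0`. -/
def Concise {mdim : Fin d → ℕ} (T : Tensor mdim) : Prop :=
  ∀ (i : Fin d) (v : Fin (mdim i) → ℂ),
    (∀ x : ∀ j : Fin d, Fin (mdim j) → ℂ, x i = v → T x = 0) → v = 0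

/-- Standard basis tuple indexed by a multi-index. -/
def stdTuple {mdim : Fin d → ℕ} (J : ∀ j, Fin (mdim j)) : ∀ j, Fin (mdim j) → ℂ :=
  fun j => Pi.single (J j) 1

/-- Sum of squares of the entries of the slice of `T` along `v` in slot `i`. -/
noncomputable def sliceSq {mdim : Fin d → ℕ} (T : Tensor mdim) (i : Fin d)
    (v : Fin (mdim i) → ℂ) : ℝ :=
  ∑ J : (∀ j, Fin (mdim j)), ‖T (Function.update (stdTuple J) i v)‖ ^ 2

/-- Conciseness in a single slot. -/
def ConciseAt {mdim : Fin d → ℕ} (T : Tensor mdim) (i : Fin d) : Prop :=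
  ∀ v : Fin (mdim i) → ℂ,
    (∀ x : ∀ j : Fin d, Fin (mdim j) → ℂ, x i = v → T x = 0) → v = 0

theorem tensor_ext {mdim : Fin d → ℕ} {S T : Tensor mdim}
    (h : ∀ J, S (stdTuple J) = T (stdTuple J)) : S = T := by
  apply ContinuousMultilinearMap.toMultilinearMap_injective
  refine Module.Basis.ext_multilinear (fun i => Pi.basisFun ℂ (Fin (mdim i))) fun J => ?_
  have h2 : (fun i => (Pi.basisFun ℂ (Fin (mdim i))) (J i)) = stdTuple J := by
    funext i
    simp [stdTuple]
  rw [h2]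
  exact h J

/-- Restriction in one slot. -/
noncomputable def restr {mdim : Fin d → ℕ} (S : Tensor mdim) (i : Fin d)
    (B : (Fin (mdim i) → ℂ) →L[ℂ] (Fin (mdim i) → ℂ)) : Tensor mdim :=
  S.compContinuousLinearMap
    (Function.update (fun j => ContinuousLinearMap.id ℂ (Fin (mdim j) → ℂ)) i B)

theorem update_apply_eq {mdim : Fin d → ℕ} (i : Fin d)
    (B : (Fin (mdim i) → ℂ) →L[ℂ] (Fin (mdim i) → ℂ)) (x : ∀ j, Fin (mdim j) → ℂ) :
    (fun j => (Function.update (fun j => ContinuousLinearMap.id ℂ (Fin (mdim j) → ℂ)) i B) j (x j))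
      = Function.update x i (B (x i)) := by
  funext j
  by_cases h : j = i
  · subst h; simp
  · simp [h]

theorem restr_apply {mdim : Fin d → ℕ} (S : Tensor mdim) (i : Fin d)
    (B : (Fin (mdim i) → ℂ) →L[ℂ] (Fin (mdim i) → ℂ)) (x : ∀ j, Fin (mdim j) → ℂ) :
    restr S i B x = S (Function.update x i (B (x i))) := by
  rw [← update_apply_eq]; rfl

theorem slice_zero {mdim : Fin d → ℕ} {S : Tensor mdim} {i : Fin d} (h1 : 1 ≤ mdim i)
    (hS : ConciseAt S i) {v : Fin (mdim i) → ℂ}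
    (h : ∀ J, S (Function.update (stdTuple J) i v) = 0) : v = 0 := by
  let lam : (Fin (mdim i) → ℂ) →L[ℂ] ℂ := ∑ l, ContinuousLinearMap.proj l
  have hl : ∀ l, lam (Pi.single l 1) = 1 := by
    intro l; simp [lam]
  have h0 : restr S i (lam.smulRight v) = 0 := by
    apply tensor_ext
    intro J
    rw [restr_apply]
    have : (lam.smulRight v) (stdTuple J i) = v := by
      simp [stdTuple, hl]
    rw [this, h]; rfl
  apply hS
  rintro x hx
  have h2 := restr_apply S i (lam.smulRight v) (Function.update x i (Pi.single ⟨0, h1⟩ 1))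
  rw [h0] at h2
  simp only [Function.update_self, ContinuousLinearMap.smulRight_apply, hl, one_smul,
    Function.update_idem] at h2
  rw [← hx, Function.update_eq_self] at h2
  exact h2.symm

theorem exists_normalizer {n : ℕ} {ι : Type} [Fintype ι]
    (F : (Fin n → ℂ) →ₗ[ℂ] EuclideanSpace ℂ ι) (hF : Function.Injective F) :
    ∃ B : (Fin n → ℂ) ≃ₗ[ℂ] (Fin n → ℂ), ∀ v, ‖F (B v)‖ ^ 2 = ∑ l, ‖v l‖ ^ 2 := by
  let e := LinearEquiv.ofInjective F hF
  have hn : Module.finrank ℂ (LinearMap.range F) = n := by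
    rw [← e.finrank_eq]; simp
  let b := (stdOrthonormalBasis ℂ (LinearMap.range F)).reindex (finCongr hn)
  refine ⟨(WithLp.linearEquiv 2 ℂ (Fin n → ℂ)).symm ≪≫ₗ
    b.repr.symm.toLinearEquiv ≪≫ₗ e.symm, fun v => ?_⟩
  have h : F (e.symm (b.repr.symm (WithLp.toLp 2 v))) = b.repr.symm (WithLp.toLp 2 v) := by
    have := e.apply_symm_apply (b.repr.symm (WithLp.toLp 2 v))
    exact congrArg Subtype.val this
  have h2 : ‖F (e.symm (b.repr.symm (WithLp.toLp 2 v)))‖ = ‖WithLp.toLp 2 v‖ := by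
    rw [h]
    exact b.repr.symm.norm_map _
  change ‖F (e.symm (b.repr.symm (WithLp.toLp 2 v)))‖ ^ 2 = _
  rw [h2, EuclideanSpace.norm_sq_eq]

theorem exists_normalized {mdim : Fin d → ℕ} {S : Tensor mdim} {i : Fin d} (h1 : 1 ≤ mdim i)
    {m : ℕ} (hS : Concise S) (hr : RankLE S m) :
    ∃ (S' : Tensor mdim) (A : (Fin (mdim i) → ℂ) →L[ℂ] (Fin (mdim i) → ℂ)),
      (Concise S' ∧ RankLE S' m) ∧ (∀ x, S x = S' (Function.update x i (A (x i)))) ∧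
      ∀ v, sliceSq S' i v = ∑ l, ‖v l‖ ^ 2 := by
  let F : (Fin (mdim i) → ℂ) →ₗ[ℂ] EuclideanSpace ℂ (∀ j, Fin (mdim j)) :=
    (WithLp.linearEquiv 2 ℂ ((∀ j, Fin (mdim j)) → ℂ)).symm.toLinearMap ∘ₗ
      LinearMap.pi fun J => S.toMultilinearMap.toLinearMap (stdTuple J) i
  have hFv : ∀ v J, F v J = S (Function.update (stdTuple J) i v) := fun v J => rfl
  have hF : Function.Injective F := by
    rw [← LinearMap.ker_eq_bot, LinearMap.ker_eq_bot']
    intro v hv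
    refine slice_zero h1 (hS i) fun J => ?_
    rw [← hFv, hv]; rfl
  obtain ⟨B, hB⟩ := exists_normalizer F hF
  let Bc : (Fin (mdim i) → ℂ) →L[ℂ] (Fin (mdim i) → ℂ) := LinearMap.toContinuousLinearMap B
  let Ac : (Fin (mdim i) → ℂ) →L[ℂ] (Fin (mdim i) → ℂ) := LinearMap.toContinuousLinearMap B.symm
  have hBA : ∀ v, Bc (Ac v) = v := fun v => B.apply_symm_apply v
  have hAB : ∀ v, Ac (Bc v) = v := fun v => B.symm_apply_apply v
  have hSx : ∀ x, S x = restr S i Bc (Function.update x i (Ac (x i))) := by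
    intro x
    rw [restr_apply]
    simp [hBA]
  refine ⟨restr S i Bc, Ac, ⟨?_, ?_⟩, hSx, ?_⟩
  · intro j v hv
    by_cases hj : j = i
    · subst hj
      have h0 : Bc v = 0 := by
        apply hS j
        intro x hx
        rw [hSx]
        apply hv
        simp [hx, hAB]
      rw [← hAB v, h0, map_zero]
    · apply hS j
      intro x hx
      rw [hSx]
      apply hv
      simp [hj, hx]
  · obtain ⟨g, hg⟩ := hr
    refine ⟨fun l j => (g l j).comp
      ((Function.update (fun j => ContinuousLinearMap.id ℂ (Fin (mdim j) → ℂ)) i Bc) j), ?_⟩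
    intro x
    exact hg _
  · intro v
    rw [← hB v, EuclideanSpace.norm_sq_eq]
    unfold sliceSq
    refine Finset.sum_congr rfl fun J _ => ?_
    rw [hFv, restr_apply]
    simp [Bc]

theorem subseq_of_injective {X F : Type*} [NormedAddCommGroup X] [NormedSpace ℂ X]
    [NormedAddCommGroup F] [NormedSpace ℂ F] [FiniteDimensional ℂ F]
    (Φ : X →ₗ[ℂ] F) (hΦ : Function.Injective Φ) (u : ℕ → X) (C : ℝ) (hu : ∀ k, ‖Φ (u k)‖ ≤ C) :
    ∃ a, ∃ φ : ℕ → ℕ, StrictMono φ ∧ Filter.Tendsto (u ∘ φ) Filter.atTop (nhds a) := by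
  have : FiniteDimensional ℂ X := FiniteDimensional.of_injective Φ hΦ
  have : ProperSpace X := FiniteDimensional.proper ℂ X
  obtain ⟨K, _, hK⟩ := Φ.exists_antilipschitzWith (LinearMap.ker_eq_bot.2 hΦ)
  have hb : Bornology.IsBounded (Set.range u) := by
    rw [isBounded_iff_forall_norm_le]
    refine ⟨K * C, ?_⟩
    rintro _ ⟨k, rfl⟩
    have := hK.le_mul_dist (u k) 0
    simp only [map_zero, dist_zero_right] at this
    exact this.trans (mul_le_mul_of_nonneg_left (hu k) K.2)
  obtain ⟨a, _, φ, h1, h2⟩ := tendsto_subseq_of_bounded hb (fun n => Set.mem_range_self n)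
  exact ⟨a, φ, h1, h2⟩

theorem continuous_sliceSq {mdim : Fin d → ℕ} (i : Fin d) (v : Fin (mdim i) → ℂ) :
    Continuous fun T : Tensor mdim => sliceSq T i v := by
  unfold sliceSq
  fun_prop

/-- One step: make the tensor concise in slot `i`. -/
theorem step {mdim : Fin d → ℕ} {m : ℕ} {i : Fin d} (h1 : 1 ≤ mdim i) {T : Tensor mdim}
    (hT : T ∈ closure {S : Tensor mdim | Concise S ∧ RankLE S m}) :
    ∃ (T' : Tensor mdim) (A : (Fin (mdim i) → ℂ) →L[ℂ] (Fin (mdim i) → ℂ)),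
      T' ∈ closure {S : Tensor mdim | Concise S ∧ RankLE S m} ∧
      (∀ x, T x = T' (Function.update x i (A (x i)))) ∧ ConciseAt T' i := by
  obtain ⟨t, ht, htT⟩ := mem_closure_iff_seq_limit.1 hT
  choose S A hSm hS hsq using fun k => exists_normalized (i := i) h1 (ht k).1 (ht k).2
  have hA : ∀ k v, ∑ l, ‖A k v l‖ ^ 2 = sliceSq (t k) i v := by
    intro k v
    rw [← hsq k]
    unfold sliceSq
    refine Finset.sum_congr rfl fun J _ => ?_
    rw [hS k]
    simp
  let Φ : (Tensor mdim × ((Fin (mdim i) → ℂ) →L[ℂ] (Fin (mdim i) → ℂ))) →ₗ[ℂ]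
      (((∀ j, Fin (mdim j)) → ℂ) × (Fin (mdim i) → Fin (mdim i) → ℂ)) :=
    { toFun := fun p => (fun J => p.1 (stdTuple J), fun l => p.2 (Pi.single l 1))
      map_add' := fun p q => rfl
      map_smul' := fun c p => rfl }
  have hΦ : Function.Injective Φ := by
    rintro ⟨S1, A1⟩ ⟨S2, A2⟩ h
    have ha : ∀ J, S1 (stdTuple J) = S2 (stdTuple J) := fun J => congrFun (congrArg Prod.fst h) J
    have hb : ∀ l, A1 (Pi.single l 1) = A2 (Pi.single l 1) :=
      fun l => congrFun (congrArg Prod.snd h) l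
    refine Prod.ext (tensor_ext ha) ?_
    apply ContinuousLinearMap.coe_injective
    refine (Pi.basisFun ℂ (Fin (mdim i))).ext fun l => ?_
    simpa using hb l
  have hlim : Filter.Tendsto (fun k => fun l : Fin (mdim i) => sliceSq (t k) i (Pi.single l 1))
      Filter.atTop (nhds fun l => sliceSq T i (Pi.single l 1)) := by
    rw [tendsto_pi_nhds]
    intro l
    exact ((continuous_sliceSq i (Pi.single l 1)).tendsto T).comp htT
  obtain ⟨C, hC⟩ := isBounded_iff_forall_norm_le.1 (Metric.isBounded_range_of_tendsto _ hlim)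
  have hC' : ∀ k l, sliceSq (t k) i (Pi.single l 1) ≤ C := fun k l =>
    (Real.le_norm_self _).trans ((norm_le_pi_norm
      (fun l : Fin (mdim i) => sliceSq (t k) i (Pi.single l 1)) l).trans
        (hC _ (Set.mem_range_self k)))
  have hC0 : 0 ≤ C := (norm_nonneg _).trans (hC _ (Set.mem_range_self 0))
  have hbd : ∀ k, ‖Φ (S k, A k)‖ ≤ 1 + C := by
    intro k
    refine norm_prod_le_iff.2 ⟨?_, ?_⟩
    · refine (pi_norm_le_iff_of_nonneg (by positivity)).2 fun J => ?_
      change ‖S k (stdTuple J)‖ ≤ 1 + C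
      have h2 : ‖S k (Function.update (stdTuple J) i (stdTuple J i))‖ ^ 2
          ≤ sliceSq (S k) i (stdTuple J i) :=
        Finset.single_le_sum
          (f := fun J' => ‖S k (Function.update (stdTuple J') i (stdTuple J i))‖ ^ 2)
          (fun _ _ => by positivity) (Finset.mem_univ J)
      rw [Function.update_eq_self, hsq] at h2
      have h3 : ∑ l, ‖(stdTuple J i : Fin (mdim i) → ℂ) l‖ ^ 2 = 1 := by
        rw [Finset.sum_eq_single (J i)]
        · simp [stdTuple]
        · intro b _ hb
          simp [stdTuple, hb]
        · simp
      rw [h3] at h2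
      nlinarith [norm_nonneg (S k (stdTuple J))]
    · refine (pi_norm_le_iff_of_nonneg (by positivity)).2 fun l => ?_
      refine (pi_norm_le_iff_of_nonneg (by positivity)).2 fun l' => ?_
      change ‖A k (Pi.single l 1) l'‖ ≤ 1 + C
      have h2 : ‖A k (Pi.single l 1) l'‖ ^ 2 ≤ ∑ l', ‖A k (Pi.single l 1) l'‖ ^ 2 :=
        Finset.single_le_sum (f := fun l' => ‖A k (Pi.single l 1) l'‖ ^ 2)
          (fun _ _ => by positivity) (Finset.mem_univ l')
      rw [hA] at h2
      have h3 := h2.trans (hC' k l)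
      nlinarith [sq_nonneg (‖A k (Pi.single l 1) l'‖ - 1)]
  obtain ⟨⟨T', A'⟩, φ, hφ, hconv⟩ := subseq_of_injective Φ hΦ (fun k => (S k, A k)) _ hbd
  have hS' : Filter.Tendsto (fun k => S (φ k)) Filter.atTop (nhds T') :=
    (continuous_fst.tendsto _).comp hconv
  have hA' : Filter.Tendsto (fun k => A (φ k)) Filter.atTop (nhds A') :=
    (continuous_snd.tendsto _).comp hconv
  have ht' : Filter.Tendsto (fun k => t (φ k)) Filter.atTop (nhds T) :=
    htT.comp hφ.tendsto_atTop
  refine ⟨T', A', ?_, ?_, ?_⟩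
  · exact mem_closure_of_tendsto hS' (Filter.Eventually.of_forall fun k => hSm (φ k))
  · intro x
    have e1 : Filter.Tendsto (fun k => t (φ k) x) Filter.atTop (nhds (T x)) :=
      ((continuous_eval_const x).tendsto T).comp ht'
    have e2 : Filter.Tendsto (fun k => A (φ k) (x i)) Filter.atTop (nhds (A' (x i))) :=
      ((continuous_eval_const (x i)).tendsto A').comp hA'
    have e3 : Filter.Tendsto (fun k => Function.update x i (A (φ k) (x i))) Filter.atTop
        (nhds (Function.update x i (A' (x i)))) :=
      tendsto_const_nhds.update i e2
    have e4 : Filter.Tendsto (fun k => S (φ k) (Function.update x i (A (φ k) (x i)))) Filter.atTop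
        (nhds (T' (Function.update x i (A' (x i))))) := hS'.eval e3
    refine tendsto_nhds_unique e1 (e4.congr fun k => ?_)
    rw [hS]
  · intro v hv
    have e1 : Filter.Tendsto (fun k => sliceSq (S (φ k)) i v) Filter.atTop
        (nhds (sliceSq T' i v)) := ((continuous_sliceSq i v).tendsto T').comp hS'
    simp only [hsq] at e1
    have e2 := tendsto_nhds_unique e1 tendsto_const_nhds
    have e3 : sliceSq T' i v = 0 := by
      unfold sliceSq
      refine Finset.sum_eq_zero fun J _ => ?_
      rw [hv _ (by simp)]
      simp
    rw [e3] at e2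
    have e4 := (Finset.sum_eq_zero_iff_of_nonneg (fun l _ => by positivity)).1 e2.symm
    funext l
    simpa using e4 l (Finset.mem_univ l)

theorem concise_on {mdim : Fin d → ℕ} {m : ℕ} (h1 : ∀ i, 1 ≤ mdim i) {T : Tensor mdim}
    (hT : T ∈ closure {S : Tensor mdim | Concise S ∧ RankLE S m}) (s : Finset (Fin d)) :
    ∃ (T' : Tensor mdim)
      (ψ : ∀ i : Fin d, ((Fin (mdim i) → ℂ) →L[ℂ] (Fin (mdim i) → ℂ))),
      T' ∈ closure {S : Tensor mdim | Concise S ∧ RankLE S m} ∧ (∀ i ∈ s, ConciseAt T' i) ∧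
      ∀ x : ∀ i : Fin d, Fin (mdim i) → ℂ, T x = T' (fun i => ψ i (x i)) := by
  induction s using Finset.induction_on with
  | empty => exact ⟨T, fun i => ContinuousLinearMap.id ℂ _, hT, by simp, fun x => rfl⟩
  | insert i s _ ih =>
    obtain ⟨T1, ψ, hcl, hc, hx⟩ := ih
    obtain ⟨T2, A, hcl2, hx2, hc2⟩ := step (h1 i) hcl
    refine ⟨T2, fun j => ((Function.update
      (fun j => ContinuousLinearMap.id ℂ (Fin (mdim j) → ℂ)) i A) j).comp (ψ j), hcl2, ?_, ?_⟩
    · intro j hj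
      by_cases hji : j = i
      · subst hji; exact hc2
      · have hjs : j ∈ s := (Finset.mem_insert.1 hj).resolve_left hji
        intro v hv
        apply hc j hjs v
        intro x hxv
        rw [hx2]
        apply hv
        simp [hji, hxv]
    · intro x
      rw [hx, hx2, ← update_apply_eq]
      rfl

/-- **Algorithmic construction of concise unrestrictions, Segre case.**
If `T` lies in the closure of the set of tensors that are concise and of rank at most `m`,
then `T` is a restriction, by continuous linear maps `ψ_i : ℂ^{m_i} → ℂ^{m_i}`, of a
concise tensor `T'` of border rank at most `m`. -/
theorem algorithmic_concise_unrestriction_segre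
    (d m : ℕ) (hd : 1 ≤ d) (hm : 1 ≤ m)
    (mdim : Fin d → ℕ) (hmdim : ∀ i, 1 ≤ mdim i)
    (T : Tensor mdim)
    (hT : T ∈ closure {S : Tensor mdim | Concise S ∧ RankLE S m}) :
    ∃ (T' : Tensor mdim)
      (ψ : ∀ i : Fin d, ((Fin (mdim i) → ℂ) →L[ℂ] (Fin (mdim i) → ℂ))),
      Concise T' ∧ BorderRankLE T' m ∧
      ∀ x : ∀ i : Fin d, Fin (mdim i) → ℂ, T x = T' (fun i => ψ i (x i)) := by
  obtain ⟨T', ψ, hcl, hc, hx⟩ := concise_on hmdim hT Finset.univ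
  exact ⟨T', ψ, fun i => hc i (Finset.mem_univ i), closure_mono (fun S hS => hS.2) hcl, hx⟩

end Stmt2
end

section
/- (Corollary: concise unrestrictions of polynomials.) Fix integers ν ≥ 1, n ≥ 1 and m ≥ 1, and let F be a symmetric order-ν tensor (a symmetric continuous multilinear map (ℂ^n)^ν → ℂ, modelling an element of S^ν ℂ^n). If F lies in the closure of the set of symmetric tensors which are concise and have rank at most m, then there exist a concise symmetric tensor F' of border rank at most m and a continuous linear map ψ : ℂ^n → ℂ^n such that F(x_1,…,x_ν) = F'(ψ(x_1),…,ψ(x_ν)) for all x_1,…,x_ν. -/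
/-!
Statement 3: concise unrestrictions of polynomials (symmetric tensors).
-/

open scoped BigOperators

namespace Stmt3

/-- Symmetric order-`ν` tensors on `ℂ^n`, modelled as continuous multilinear maps
`(ℂ^n)^ν → ℂ`. -/
abbrev SymSpace (ν n : ℕ) : Type :=
  ContinuousMultilinearMap ℂ (fun _ : Fin ν => (Fin n → ℂ)) ℂ

/-- Symmetry: invariance under all permutations of the arguments. -/
def IsSym {ν n : ℕ} (F : SymSpace ν n) : Prop :=
  ∀ (σ : Equiv.Perm (Fin ν)) (x : Fin ν → (Fin n → ℂ)), F (fun j => x (σ j)) = F x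

/-- Symmetric rank at most `r`: the same linear functional in all `ν` arguments of each
summand. -/
def SymRankLE {ν n : ℕ} (F : SymSpace ν n) (r : ℕ) : Prop :=
  ∃ g : Fin r → ((Fin n → ℂ) →L[ℂ] ℂ),
    ∀ x, F x = ∑ l : Fin r, ∏ j : Fin ν, g l (x j)

/-- Conciseness: the only `v` such that `F` vanishes on every argument tuple whose first
entry is `v` is `v = 0`. -/
def ConciseSym {ν n : ℕ} (hν : 0 < ν) (F : SymSpace ν n) : Prop :=
  ∀ v : Fin n → ℂ, (∀ x : Fin ν → (Fin n → ℂ), x ⟨0, hν⟩ = v → F x = 0) → v = 0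

/-- Border rank at most `r`: lies in the closure of the set of symmetric tensors of rank at
most `r`. -/
def SymBorderRankLE {ν n : ℕ} (F : SymSpace ν n) (r : ℕ) : Prop :=
  F ∈ closure {S : SymSpace ν n | IsSym S ∧ SymRankLE S r}

/-- Precomposition with one linear map in all arguments. -/
noncomputable abbrev cp {ν n : ℕ} (G : SymSpace ν n) (B : (Fin n → ℂ) →L[ℂ] (Fin n → ℂ)) :
    SymSpace ν n :=
  G.compContinuousLinearMap (fun _ => B)

/-- Kernel of the first flattening. -/
noncomputable def ker0 {ν n : ℕ} (hν : 0 < ν) (F : SymSpace ν n) : Submodule ℂ (Fin n → ℂ) :=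
  ⨅ x : Fin ν → (Fin n → ℂ), LinearMap.ker (F.toContinuousLinearMap x ⟨0, hν⟩).toLinearMap

lemma mem_ker0 {ν n : ℕ} (hν : 0 < ν) (F : SymSpace ν n) (v : Fin n → ℂ) :
    v ∈ ker0 hν F ↔ ∀ x : Fin ν → (Fin n → ℂ), F (Function.update x ⟨0, hν⟩ v) = 0 := by
  simp [ker0, Submodule.mem_iInf]

lemma concise_iff {ν n : ℕ} (hν : 0 < ν) (F : SymSpace ν n) :
    ConciseSym hν F ↔ ker0 hν F = ⊥ := by
  rw [Submodule.eq_bot_iff]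
  unfold ConciseSym
  refine forall_congr' fun v => ?_
  rw [mem_ker0]
  refine imp_congr_left ⟨fun h x => h _ (by simp), fun h x hx => ?_⟩
  have := h x
  rwa [← hx, Function.update_eq_self] at this

/-- The set of concise symmetric tensors of bounded rank. -/
def good {ν n : ℕ} (hν : 0 < ν) (m : ℕ) : Set (SymSpace ν n) :=
  {S : SymSpace ν n | IsSym S ∧ ConciseSym hν S ∧ SymRankLE S m}

lemma good_cp {ν n m : ℕ} (hν : 0 < ν) {G : SymSpace ν n} (hG : G ∈ good hν m)
    {B : (Fin n → ℂ) →L[ℂ] (Fin n → ℂ)} (hB : IsUnit B) : cp G B ∈ good hν m := by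
  obtain ⟨h1, h2, g, hg⟩ := hG
  obtain ⟨u, rfl⟩ := hB
  refine ⟨fun σ x => ?_, fun v hv => ?_, fun l => (g l).comp u.1, fun x => ?_⟩
  · simpa using h1 σ (fun j => u.1 (x j))
  · have e1 : ∀ y, u.1 (u⁻¹.1 y) = y := fun y => by
      have := u.mul_inv
      exact congrArg (fun f => f y) this
    have e2 : ∀ y, u⁻¹.1 (u.1 y) = y := fun y => by
      have := u.inv_mul
      exact congrArg (fun f => f y) this
    have : u.1 v = 0 := by
      refine h2 _ fun y hy => ?_
      have := hv (fun j => u⁻¹.1 (y j)) (by simp only [hy, e2])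
      simpa [e1] using this
    rw [← e2 v, this, map_zero]
  · simp [hg]

lemma isSym_closed {ν n : ℕ} : IsClosed {S : SymSpace ν n | IsSym S} := by
  simp only [IsSym, Set.ofPred_forall]
  refine isClosed_iInter fun σ => isClosed_iInter fun x => isClosed_eq ?_ ?_
  · exact (ContinuousMultilinearMap.apply ℂ _ ℂ (fun j => x (σ j))).continuous
  · exact (ContinuousMultilinearMap.apply ℂ _ ℂ x).continuous

lemma isSym_of_closure {ν n m : ℕ} (hν : 0 < ν) {F : SymSpace ν n}
    (hF : F ∈ closure (good hν m)) : IsSym F :=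
  closure_minimal (fun _ h => h.1) isSym_closed hF

/-- A symmetric tensor vanishes as soon as one argument lies in the kernel. -/
lemma sym_ker0 {ν n : ℕ} (hν : 0 < ν) {F : SymSpace ν n} (hF : IsSym F) {v : Fin n → ℂ}
    (hv : v ∈ ker0 hν F) (i : Fin ν) (x : Fin ν → (Fin n → ℂ)) :
    F (Function.update x i v) = 0 := by
  rw [mem_ker0] at hv
  rw [← hF (Equiv.swap ⟨0, hν⟩ i)]
  rw [← hv (fun j => (Function.update x i v) (Equiv.swap ⟨0, hν⟩ i j))]
  congr 1
  ext1 j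
  by_cases hj : j = ⟨0, hν⟩
  · subst hj; simp
  · simp [hj]

lemma cp_proj {ν n : ℕ} (hν : 0 < ν) {F : SymSpace ν n} (hF : IsSym F)
    {P : (Fin n → ℂ) →L[ℂ] (Fin n → ℂ)} (hP : ∀ v, v - P v ∈ ker0 hν F) : cp F P = F := by
  ext x
  have key : ∀ s : Finset (Fin ν), F (fun j => if j ∈ s then P (x j) else x j) = F x := by
    intro s
    induction s using Finset.induction_on with
    | empty => simp
    | insert a s ha ih =>
      rw [← ih]
      set y : Fin ν → (Fin n → ℂ) := fun j => if j ∈ s then P (x j) else x j with hy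
      have e1 : (fun j => if j ∈ insert a s then P (x j) else x j)
          = Function.update y a (P (x a)) := by
        ext1 j
        by_cases hj : j = a
        · subst hj; simp
        · simp [hj, hy]
      have e2 : y = Function.update y a (P (x a) + (x a - P (x a))) := by
        rw [eq_comm, Function.update_eq_iff]
        simp [hy, ha]
      rw [e1]
      conv_rhs => rw [e2, F.map_update_add, sym_ker0 hν hF (hP (x a)), add_zero]
  simpa using key Finset.univ

lemma cp_cp {ν n : ℕ} (G : SymSpace ν n) (A B : (Fin n → ℂ) →L[ℂ] (Fin n → ℂ)) :
    cp (cp G A) B = cp G (A * B) := by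
  ext x; simp

lemma cp_one {ν n : ℕ} (G : SymSpace ν n) : cp G 1 = G := by
  ext x; simp

lemma continuous_cp {ν n : ℕ} : Continuous
    (fun p : SymSpace ν n × ((Fin n → ℂ) →L[ℂ] (Fin n → ℂ)) => cp p.1 p.2) := by
  have h := (ContinuousMultilinearMap.compContinuousLinearMapContinuousMultilinear ℂ
    (fun _ : Fin ν => (Fin n → ℂ)) (fun _ : Fin ν => (Fin n → ℂ)) ℂ).cont
  have h2 : Continuous (fun p : SymSpace ν n × ((Fin n → ℂ) →L[ℂ] (Fin n → ℂ)) =>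
      (ContinuousMultilinearMap.compContinuousLinearMapContinuousMultilinear ℂ
    (fun _ : Fin ν => (Fin n → ℂ)) (fun _ : Fin ν => (Fin n → ℂ)) ℂ) (fun _ => p.2)) :=
    h.comp (continuous_pi fun _ => continuous_snd)
  exact h2.clm_apply continuous_fst

instance finDimSym {ν n : ℕ} : FiniteDimensional ℂ (SymSpace ν n) :=
  FiniteDimensional.of_injective
    (ContinuousMultilinearMap.toMultilinearMapLinear (R' := ℂ) (A := ℂ)
      (M₁ := fun _ : Fin ν => (Fin n → ℂ)) (M₂ := ℂ))
    ContinuousMultilinearMap.toMultilinearMap_injective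

lemma exists_e {ν n : ℕ} (hν : 0 < ν) {F : SymSpace ν n} (hF : IsSym F)
    {P : (Fin n → ℂ) →L[ℂ] (Fin n → ℂ)} (hP : ∀ v, v - P v ∈ ker0 hν F)
    (hK : ∀ v ∈ ker0 hν F, P v = 0) (p : (Fin n → ℂ) →ₗ[ℂ] ℂ)
    (hp : ∀ v, P v = 0 → p v = 0) :
    ∃ e : SymSpace ν n →ₗ[ℂ] ((Fin n → ℂ) →ₗ[ℂ] ℂ), e F = p ∧
      (∀ G B, B * P = P → ∀ v, e (cp G B) v = e G (B v)) ∧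
      (∀ G, ∀ v ∈ ker0 hν G, e G v = 0) := by
  have hPP : ∀ v, P (P v) = P v := fun v => by
    have := hK _ (hP v)
    rw [map_sub, sub_eq_zero] at this
    exact this.symm
  have hFP := cp_proj hν hF hP
  let L : (Fin ν → (Fin n → ℂ)) → ((Fin n → ℂ) →ₗ[ℂ] ℂ) := fun x =>
    (F.toContinuousLinearMap (fun j => P (x j)) ⟨0, hν⟩).toLinearMap
  have hspan : p ∈ Submodule.span ℂ (Set.range L) := by
    refine FiniteDimensional.mem_span_of_iInf_ker_le_ker fun v hv => ?_
    simp only [Submodule.mem_iInf, LinearMap.mem_ker] at hv ⊢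
    refine hp v (hK v ?_)
    rw [mem_ker0]
    intro x
    have h1 : F (Function.update (fun j => P (x j)) ⟨0, hν⟩ v) = 0 := hv x
    rw [← hFP] at h1 ⊢
    rw [← h1]
    simp only [ContinuousMultilinearMap.compContinuousLinearMap_apply]
    congr 1
    ext1 j
    by_cases hj : j = ⟨0, hν⟩
    · subst hj; simp
    · simp [hj, hPP]
  clear hp
  induction hspan using Submodule.span_induction with
  | mem p h =>
    obtain ⟨x, rfl⟩ := h
    refine ⟨{ toFun := fun G => (G.toContinuousLinearMap (fun j => P (x j)) ⟨0, hν⟩).toLinearMap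
              map_add' := fun G H => by ext v; simp
              map_smul' := fun c G => by ext v; simp }, rfl, ?_, ?_⟩
    · intro G B hB v
      simp only [LinearMap.coe_mk, AddHom.coe_mk, ContinuousLinearMap.coe_coe,
        ContinuousMultilinearMap.toContinuousLinearMap_apply,
        ContinuousMultilinearMap.compContinuousLinearMap_apply]
      congr 1
      ext1 j
      by_cases hj : j = ⟨0, hν⟩
      · subst hj; simp
      · have := congrArg (fun f => f (x j)) hB
        simpa [hj] using this
    · intro G v hv
      exact (mem_ker0 hν G v).1 hv _
  | zero => exact ⟨0, by simp⟩
  | add p q _ _ h1 h2 =>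
    obtain ⟨e, he, he1, he2⟩ := h1
    obtain ⟨f, hf, hf1, hf2⟩ := h2
    refine ⟨e + f, by simp [he, hf], fun G B hB v => ?_, fun G v hv => ?_⟩
    · simp [he1 G B hB, hf1 G B hB]
    · simp [he2 G v hv, hf2 G v hv]
  | smul c p _ h1 =>
    obtain ⟨e, he, he1, he2⟩ := h1
    refine ⟨c • e, by simp [he], fun G B hB v => ?_, fun G v hv => ?_⟩
    · simp [he1 G B hB]
    · simp [he2 G v hv]

lemma exists_M {ν n : ℕ} (hν : 0 < ν) {F : SymSpace ν n} (hF : IsSym F)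
    {P : (Fin n → ℂ) →L[ℂ] (Fin n → ℂ)} (hP : ∀ v, v - P v ∈ ker0 hν F)
    (hK : ∀ v ∈ ker0 hν F, P v = 0) :
    ∃ M : SymSpace ν n →ₗ[ℂ] ((Fin n → ℂ) →L[ℂ] (Fin n → ℂ)), M F = P ∧
      (∀ G B, B * P = P → M (cp G B) = M G * B) ∧
      (∀ G, ∀ v ∈ ker0 hν G, M G v = 0) ∧ (∀ G, P * M G = M G) := by
  have hPP : ∀ v, P (P v) = P v := fun v => by
    have := hK _ (hP v)
    rw [map_sub, sub_eq_zero] at this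
    exact this.symm
  have h := fun i : Fin n => exists_e hν hF hP hK
    ((LinearMap.proj i : (Fin n → ℂ) →ₗ[ℂ] ℂ) ∘ₗ P.toLinearMap) (fun v hv => by simp [hv])
  choose e he he1 he2 using h
  refine ⟨{ toFun := fun G => P * LinearMap.toContinuousLinearMap (LinearMap.pi fun i => e i G)
            map_add' := fun G H => ?_
            map_smul' := fun c G => ?_ }, ?_, ?_, ?_, ?_⟩
  · ext1 v
    simp only [mul_apply_eq_comp, add_apply, ← map_add]
    congr 1; ext i; simp
  · ext1 v
    simp only [mul_apply_eq_comp, smul_apply, RingHom.id_apply,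
      ← map_smul]
    congr 1; ext i; simp
  · ext1 v
    conv_rhs => rw [← hPP v]
    simp only [LinearMap.coe_mk, AddHom.coe_mk, mul_apply_eq_comp]
    congr 1; ext i; simp [he]
  · intro G B hB
    ext1 v
    simp only [LinearMap.coe_mk, AddHom.coe_mk, mul_apply_eq_comp]
    congr 1; ext i; simp [he1 i G B hB]
  · intro G v hv
    simp only [LinearMap.coe_mk, AddHom.coe_mk, mul_apply_eq_comp]
    rw [← map_zero P]
    congr 1; ext i; simp [he2 i G v hv]
  · intro G
    ext1 v
    simp only [LinearMap.coe_mk, AddHom.coe_mk, mul_apply_eq_comp, hPP]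

lemma clm_smul_mul {n : ℕ} (c : ℂ) (A B : (Fin n → ℂ) →L[ℂ] (Fin n → ℂ)) :
    (c • A) * B = c • (A * B) := by
  ext1 v; rfl

lemma clm_mul_smul {n : ℕ} (c : ℂ) (A B : (Fin n → ℂ) →L[ℂ] (Fin n → ℂ)) :
    A * (c • B) = c • (A * B) := by
  ext1 v; exact A.map_smul c (B v)

lemma clm_smul_zero {n : ℕ} (c : ℂ) : c • (0 : (Fin n → ℂ) →L[ℂ] (Fin n → ℂ)) = 0 := by
  ext1 v; exact smul_zero c

lemma clm_inv {n : ℕ} {P Q : (Fin n → ℂ) →L[ℂ] (Fin n → ℂ)} (hPQ : P + Q = 1)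
    (hPP : P * P = P) (h1 : P * Q = 0) (h2 : Q * P = 0) (h3 : Q * Q = Q) {c d : ℂ}
    (hcd : c * d = 1) : (P + c • Q) * (P + d • Q) = 1 := by
  have h4 : c • (d • Q) = Q := by
    ext1 v
    change c • (d • Q v) = Q v
    rw [smul_smul, hcd, one_smul]
  rw [add_mul, mul_add, mul_add, hPP, clm_smul_mul, clm_smul_mul, clm_mul_smul, clm_mul_smul,
    h1, h2, h3, h4, clm_smul_zero, clm_smul_zero, add_zero, zero_add, hPQ]

/-- Blowing up the kernel direction of a nearby concise tensor until the distance is one. -/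
lemma blowup {ν n : ℕ} (hν : 0 < ν) {F G : SymSpace ν n}
    {P Q : (Fin n → ℂ) →L[ℂ] (Fin n → ℂ)} (hPQ : P + Q = 1)
    {κ : Fin n → ℂ} (hκ : κ ≠ 0) (hPκ : P κ = 0) (hPP : P * P = P)
    (hG : ConciseSym hν G) (hd : ‖G - F‖ < 1) :
    ∃ t : ℝ, 1 ≤ t ∧ ‖cp G (P + (t : ℂ) • Q) - F‖ = 1 := by
  have hQ : Q = 1 - P := by rw [← hPQ]; abel
  have hQκ : Q κ = κ := by simp [hQ, hPκ]
  have hinv : ∀ t : ℝ, 1 ≤ t → (P + (t : ℂ) • Q) * (P + (t : ℂ)⁻¹ • Q) = 1 := by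
    intro t ht
    have ht0 : (t : ℂ) ≠ 0 := by
      have : t ≠ 0 := by linarith
      exact_mod_cast this
    have h1 : P * Q = 0 := by rw [hQ, mul_sub, hPP]; simp
    have h2 : Q * P = 0 := by rw [hQ, sub_mul, hPP]; simp
    have h3 : Q * Q = Q := by
      conv_lhs => rw [hQ, sub_mul, ← hQ, h1]
      simp
    exact clm_inv hPQ hPP h1 h2 h3 (mul_inv_cancel₀ ht0)
  let f : ℝ → ℝ := fun t => ‖cp G (P + (t : ℂ) • Q) - F‖
  have hf : Continuous f := by
    have h1 : Continuous (fun t : ℝ => (G, P + (t : ℂ) • Q)) := by fun_prop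
    exact ((continuous_cp.comp h1).sub continuous_const).norm
  have hf1 : f 1 < 1 := by
    simp only [f, Complex.ofReal_one, one_smul, hPQ, cp_one, hd]
  have hbig : ∃ T : ℝ, 1 ≤ T ∧ 1 ≤ f T := by
    by_contra! hcon
    obtain ⟨x, hx0, hx⟩ : ∃ x : Fin ν → (Fin n → ℂ), x ⟨0, hν⟩ = κ ∧ G x ≠ 0 := by
      by_contra! h
      exact hκ (hG κ h)
    set C : ℝ := (1 + ‖F‖) * ∏ j, (‖P (x j)‖ + ‖Q (x j)‖) with hC
    have hb : ∀ t : ℝ, 1 ≤ t → ‖G x‖ ≤ C * t⁻¹ := by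
      intro t ht
      have htp : 0 < t := by linarith
      set H := cp G (P + (t : ℂ) • Q) with hH
      have hHn : ‖H‖ ≤ 1 + ‖F‖ := by
        have h1 : ‖H - F‖ < 1 := hcon t ht
        have := norm_le_norm_sub_add H F
        linarith
      have hx2 : G x = H (Function.update (fun j => P (x j) + (t : ℂ)⁻¹ • Q (x j)) ⟨0, hν⟩
          ((t : ℂ)⁻¹ • κ)) := by
        rw [hH]
        simp only [ContinuousMultilinearMap.compContinuousLinearMap_apply]
        congr 1
        ext1 j
        have e := congrArg (fun f => f (x j)) (hinv t ht)
        by_cases hj : j = ⟨0, hν⟩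
        · subst hj
          have e3 : (t : ℂ)⁻¹ • κ = P (x ⟨0, hν⟩) + (t : ℂ)⁻¹ • Q (x ⟨0, hν⟩) := by
            rw [hx0, hPκ, hQκ, zero_add]
          rw [Function.update_self, e3]
          exact e.symm
        · rw [Function.update_of_ne hj]
          exact e.symm
      rw [hx2, H.map_update_smul, norm_smul, norm_inv, Complex.norm_real, Real.norm_of_nonneg htp.le,
        mul_comm]
      refine mul_le_mul_of_nonneg_right ?_ (by positivity)
      refine (H.le_opNorm _).trans ?_
      rw [hC]
      refine mul_le_mul hHn ?_ (Finset.prod_nonneg fun _ _ => norm_nonneg _) (by positivity)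
      refine Finset.prod_le_prod (fun _ _ => norm_nonneg _) fun j _ => ?_
      by_cases hj : j = ⟨0, hν⟩
      · subst hj
        rw [Function.update_self, hx0, hPκ, hQκ]; simp
      · rw [Function.update_of_ne hj]
        refine (norm_add_le _ _).trans ?_
        gcongr
        rw [norm_smul, norm_inv, Complex.norm_real, Real.norm_of_nonneg htp.le]
        exact mul_le_of_le_one_left (norm_nonneg _) (inv_le_one_of_one_le₀ ht)
    have hlim : Filter.Tendsto (fun t : ℝ => C * t⁻¹) Filter.atTop (nhds (C * 0)) :=
      tendsto_inv_atTop_zero.const_mul C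
    have := ge_of_tendsto hlim (Filter.eventually_atTop.2 ⟨1, hb⟩)
    rw [mul_zero] at this
    exact hx (norm_le_zero_iff.1 this)
  obtain ⟨T, hT, hT2⟩ := hbig
  obtain ⟨t, ht, ht2⟩ := intermediate_value_Icc hT hf.continuousOn ⟨hf1.le, hT2⟩
  exact ⟨t, ht.1, ht2⟩

lemma step {ν n m : ℕ} (hν : 0 < ν) {F : SymSpace ν n}
    (hF : F ∈ closure (good hν m)) (hne : ker0 hν F ≠ ⊥) :
    ∃ (H : SymSpace ν n) (P : (Fin n → ℂ) →L[ℂ] (Fin n → ℂ)), H ∈ closure (good hν m) ∧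
      cp H P = F ∧ ker0 hν H < ker0 hν F := by
  have hsym := isSym_of_closure hν hF
  obtain ⟨κ, hκK, hκ⟩ := Submodule.exists_mem_ne_zero_of_ne_bot hne
  obtain ⟨q, hq⟩ := (ker0 hν F).subtype.exists_leftInverse_of_injective (Submodule.ker_subtype _)
  let Q : (Fin n → ℂ) →L[ℂ] (Fin n → ℂ) :=
    LinearMap.toContinuousLinearMap ((ker0 hν F).subtype ∘ₗ q)
  have hQK : ∀ v, Q v ∈ ker0 hν F := fun v => (q v).2
  have hQid : ∀ v ∈ ker0 hν F, Q v = v := fun v hv => by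
    have := congrArg (fun f => f ⟨v, hv⟩) hq
    exact congrArg Subtype.val this
  obtain ⟨P, hPdef⟩ : ∃ P, P = 1 - Q := ⟨_, rfl⟩
  have hPQ : P + Q = 1 := by rw [hPdef]; abel
  have hP : ∀ v, v - P v ∈ ker0 hν F := fun v => by simpa [hPdef] using hQK v
  have hK : ∀ v ∈ ker0 hν F, P v = 0 := fun v hv => by simp [hPdef, hQid v hv]
  have hPQ0 : P * Q = 0 := by ext1 v; exact hK _ (hQK v)
  have hPP : P * P = P := by
    conv_lhs => rw [hPdef, mul_sub, ← hPdef, hPQ0]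
    simp
  have hQP : Q * P = 0 := by
    have : Q = 1 - P := by rw [← hPQ]; abel
    rw [this, sub_mul, hPP]; simp
  have hQQ : Q * Q = Q := by ext1 v; exact hQid _ (hQK v)
  clear_value Q
  obtain ⟨M, hMF, hMcp, hMker, hPM⟩ := exists_M hν hsym hP hK
  have hMc : Continuous M := LinearMap.continuous_of_finiteDimensional M
  let S : SymSpace ν n → ((Fin n → ℂ) →L[ℂ] (Fin n → ℂ)) :=
    fun G => P + Ring.inverse (M G + Q) * Q
  have hSF : S F = 1 := by simp [S, hMF, hPQ]
  have hTc : ContinuousAt (fun G => M G + Q) F := (hMc.add continuous_const).continuousAt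
  have hScont : ContinuousAt S F := by
    refine continuousAt_const.add (ContinuousAt.mul ?_ continuousAt_const)
    refine ContinuousAt.comp (g := Ring.inverse) (f := fun G => M G + Q) ?_ hTc
    have := NormedRing.inverse_continuousAt (1 : ((Fin n → ℂ) →L[ℂ] (Fin n → ℂ))ˣ)
    simpa [hMF, hPQ] using this
  let Γ : SymSpace ν n → SymSpace ν n := fun G => cp G (S G)
  have hΓF : Γ F = F := by simp only [Γ, hSF, cp_one]
  have hΓc : ContinuousAt Γ F :=
    ContinuousAt.comp (g := fun p : SymSpace ν n × ((Fin n → ℂ) →L[ℂ] (Fin n → ℂ)) => cp p.1 p.2)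
      (f := fun G => (G, S G)) continuous_cp.continuousAt (continuousAt_id.prodMk hScont)
  have ev1 : ∀ᶠ G in nhds F, IsUnit (M G + Q) := by
    refine hTc.eventually (Units.isOpen.mem_nhds ?_)
    simp [hMF, hPQ]
  have ev2 : ∀ᶠ G in nhds F, IsUnit (S G) := by
    refine hScont.eventually (Units.isOpen.mem_nhds ?_)
    simp [hSF]
  have ev3 : ∀ᶠ G in nhds F, ‖Γ G - F‖ < 1 := by
    have := hΓc.eventually (Metric.ball_mem_nhds (Γ F) one_pos)
    filter_upwards [this] with G hG
    rwa [hΓF, dist_eq_norm] at hG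
  have main : ∀ᶠ G in nhds F, G ∈ good hν m → ∃ H ∈ good hν m, ‖H - F‖ = 1 ∧
      cp H P = cp (Γ G) P ∧ M H * Q = 0 := by
    filter_upwards [ev1, ev2, ev3] with G h1 h2 h3 hG
    have hΓG : Γ G ∈ good hν m := good_cp hν hG h2
    obtain ⟨t, ht, htn⟩ := blowup hν hPQ hκ (hK κ hκK) hPP hΓG.2.1 h3
    have ht0 : (t : ℂ) ≠ 0 := by
      have : t ≠ 0 := by linarith
      exact_mod_cast this
    have u1 := clm_inv hPQ hPP hPQ0 hQP hQQ (mul_inv_cancel₀ ht0)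
    have u2 := clm_inv hPQ hPP hPQ0 hQP hQQ (inv_mul_cancel₀ ht0)
    have hu : IsUnit (P + (t : ℂ) • Q) := ⟨⟨_, _, u1, u2⟩, rfl⟩
    have hBP : (P + (t : ℂ) • Q) * P = P := by
      rw [add_mul, clm_smul_mul, hPP, hQP, clm_smul_zero, add_zero]
    have hSP : S G * P = P := by
      simp only [S]
      rw [add_mul, mul_assoc, hPP, hQP, mul_zero, add_zero]
    refine ⟨_, good_cp hν hΓG hu, htn, ?_, ?_⟩
    · rw [cp_cp, hBP]
    · rw [hMcp _ _ hBP, hMcp _ _ hSP]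
      have e1 : (P + (t : ℂ) • Q) * Q = (t : ℂ) • Q := by
        rw [add_mul, clm_smul_mul, hPQ0, hQQ, zero_add]
      have e2 : S G * Q = Ring.inverse (M G + Q) * Q := by
        simp only [S]
        rw [add_mul, mul_assoc, hPQ0, hQQ, zero_add]
      rw [mul_assoc, e1, clm_mul_smul, mul_assoc, e2]
      have e3 : (M G + Q) * (Ring.inverse (M G + Q) * Q) = Q := by
        rw [← mul_assoc, Ring.mul_inverse_cancel _ h1, one_mul]
      have e4 : M G * (Ring.inverse (M G + Q) * Q) = 0 := by
        have := congrArg (fun A => P * A) e3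
        simp only [add_mul, mul_add] at this
        rw [← mul_assoc P, ← mul_assoc P, hPM, hPQ0, zero_mul, add_zero] at this
        exact this
      rw [e4, clm_smul_zero]
  obtain ⟨u, hu, hulim⟩ := mem_closure_iff_seq_limit.1 hF
  obtain ⟨N, hN⟩ := Filter.eventually_atTop.1 (hulim.eventually main)
  choose! H hHg hHn hHP hHM using fun k (hk : N ≤ k) => hN k hk (hu k)
  have : ProperSpace (SymSpace ν n) := FiniteDimensional.proper ℂ _
  obtain ⟨H0, hH0, φ, hφ, hlim⟩ := (isCompact_sphere F 1).tendsto_subseq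
    (x := fun k => H (k + N)) (fun k => by
      rw [mem_sphere_iff_norm]; exact hHn _ (Nat.le_add_left _ _))
  have hcpP : Continuous (fun G : SymSpace ν n => cp G P) :=
    continuous_cp.comp (continuous_id.prodMk continuous_const)
  have hH0P : cp H0 P = F := by
    have l1 := (hcpP.tendsto H0).comp hlim
    have l2 : Filter.Tendsto (fun k => cp (Γ (u (φ k + N))) P) Filter.atTop (nhds (cp (Γ F) P)) := by
      refine (hcpP.tendsto _).comp (hΓc.tendsto.comp (hulim.comp ?_))
      exact (Filter.tendsto_add_atTop_nat N).comp hφ.tendsto_atTop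
    rw [hΓF, cp_proj hν hsym hP] at l2
    refine tendsto_nhds_unique l1 (l2.congr fun k => ?_)
    exact (hHP _ (Nat.le_add_left _ _)).symm
  have hH0M : M H0 * Q = 0 := by
    have hc : Continuous (fun G => M G * Q) := hMc.mul continuous_const
    have l1 := (hc.tendsto H0).comp hlim
    refine tendsto_nhds_unique l1 (tendsto_const_nhds.congr fun k => ?_)
    exact (hHM _ (Nat.le_add_left _ _)).symm
  have hH0c : H0 ∈ closure (good hν m) :=
    mem_closure_of_tendsto hlim (Filter.Eventually.of_forall fun k => hHg _ (Nat.le_add_left _ _))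
  have hMP : M H0 = P := by
    calc M H0 = M H0 * (P + Q) := by rw [hPQ, mul_one]
      _ = M (cp H0 P) := by rw [mul_add, hH0M, add_zero, hMcp _ _ hPP]
      _ = P := by rw [hH0P, hMF]
  have hle : ker0 hν H0 ≤ ker0 hν F := fun v hv => by
    have := hMker H0 v hv
    rw [hMP] at this
    simpa [this] using hP v
  refine ⟨H0, P, hH0c, hH0P, lt_of_le_of_ne hle fun heq => ?_⟩
  have : cp H0 P = H0 := cp_proj hν (isSym_of_closure hν hH0c) (by rw [heq]; exact hP)
  rw [mem_sphere_iff_norm, ← this, hH0P] at hH0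
  simp at hH0

lemma induct {ν n m : ℕ} (hν : 0 < ν) (d : ℕ) : ∀ F : SymSpace ν n,
    F ∈ closure (good hν m) → Module.finrank ℂ (ker0 hν F) = d →
    ∃ (F' : SymSpace ν n) (ψ : (Fin n → ℂ) →L[ℂ] (Fin n → ℂ)),
      F' ∈ closure (good hν m) ∧ ker0 hν F' = ⊥ ∧ cp F' ψ = F := by
  induction d using Nat.strong_induction_on with
  | _ d ih =>
    intro F hF hd
    by_cases hb : ker0 hν F = ⊥
    · exact ⟨F, 1, hF, hb, cp_one F⟩
    · obtain ⟨H, P, hH, hHP, hlt⟩ := step hν hF hb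
      obtain ⟨F', ψ, h1, h2, h3⟩ := ih _ (hd ▸ Submodule.finrank_lt_finrank_of_lt hlt) H hH rfl
      exact ⟨F', ψ * P, h1, h2, by rw [← cp_cp, h3, hHP]⟩

/-- **Concise unrestrictions of polynomials.**
If a symmetric tensor `F` lies in the closure of the set of symmetric tensors that are
concise and of rank at most `m`, then `F` is a restriction, by a continuous linear map
`ψ : ℂ^n → ℂ^n`, of a concise symmetric tensor `F'` of border rank at most `m`. -/
theorem concise_unrestriction_polynomials
    (ν n m : ℕ) (hν : 0 < ν) (hn : 1 ≤ n) (hm : 1 ≤ m)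
    (F : SymSpace ν n) (hFsym : IsSym F)
    (hF : F ∈ closure {S : SymSpace ν n | IsSym S ∧ ConciseSym hν S ∧ SymRankLE S m}) :
    ∃ (F' : SymSpace ν n) (ψ : (Fin n → ℂ) →L[ℂ] (Fin n → ℂ)),
      IsSym F' ∧ ConciseSym hν F' ∧ SymBorderRankLE F' m ∧
      ∀ x : Fin ν → (Fin n → ℂ), F x = F' (fun j => ψ (x j)) := by
  obtain ⟨F', ψ, h1, h2, h3⟩ := induct (m := m) hν _ F hF rfl
  refine ⟨F', ψ, isSym_of_closure hν h1, (concise_iff hν F').2 h2, ?_, fun x => ?_⟩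
  · have hsub : good hν m ⊆ {S : SymSpace ν n | IsSym S ∧ SymRankLE S m} :=
      fun S hS => ⟨hS.1, hS.2.2⟩
    exact closure_mono hsub h1
  · rw [← h3]; rfl

end Stmt3
end
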